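/- arXiv:1407.2300 — 3 statements merged into one kernel-verified Lean document; each statement's English description precedes it below -/
import Mathlib

section
/- Let K be a field and Λ a finite-dimensional associative unital K-algebra. If every finitely generated left Λ-module of finite projective dimension has projective dimension at most 1 (i.e. l.findim Λ ≤ 1), then P^∞(Λ-mod) is covariantly finite in Λ-mod; that is, every finitely generated left Λ-module M admits a homomorphism f : M → A with A finitely generated of finite projective dimension such that every homomorphism g : M → B into a finitely generated left Λ-module B of finite projective dimension factors as g = h ∘ f for some homomorphism h : A → B. -/
universe u

/-- `HasProjDimLE Λ n M` means the left `Λ`-module `M` has projective dimension `≤ n`: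
for `n = 0` it is projective, and for `n+1` there is a surjection from a projective module
whose kernel has projective dimension `≤ n`. -/
def HasProjDimLE (Λ : Type u) [Ring Λ] : ℕ → ModuleCat.{u} Λ → Prop
  | 0, M => Module.Projective Λ M
  | n + 1, M => ∃ (P : ModuleCat.{u} Λ) (g : P →ₗ[Λ] M),
      Module.Projective Λ P ∧ Function.Surjective g ∧
        HasProjDimLE Λ n (ModuleCat.of Λ (LinearMap.ker g))

/-- A module has finite projective dimension. -/
def HasFinProjDim (Λ : Type u) [Ring Λ] (M : ModuleCat.{u} Λ) : Prop :=
  ∃ n, HasProjDimLE Λ n M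

/-- `f : A → M` is a right `P^∞(Λ-mod)`-approximation of `M`. -/
def IsRightApprox (Λ : Type u) [Ring Λ] (M A : ModuleCat.{u} Λ) (f : A →ₗ[Λ] M) : Prop :=
  Module.Finite Λ A ∧ HasFinProjDim Λ A ∧
    ∀ (B : ModuleCat.{u} Λ), Module.Finite Λ B → HasFinProjDim Λ B →
      ∀ g : B →ₗ[Λ] M, ∃ h : B →ₗ[Λ] A, f ∘ₗ h = g

/-- `f : M → A` is a left `P^∞(Λ-mod)`-approximation of `M`. -/
def IsLeftApprox (Λ : Type u) [Ring Λ] (M A : ModuleCat.{u} Λ) (f : M →ₗ[Λ] A) : Prop :=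
  Module.Finite Λ A ∧ HasFinProjDim Λ A ∧
    ∀ (B : ModuleCat.{u} Λ), Module.Finite Λ B → HasFinProjDim Λ B →
      ∀ g : M →ₗ[Λ] B, ∃ h : A →ₗ[Λ] B, h ∘ₗ f = g

/-- `P^∞(Λ-mod)` is contravariantly finite in `Λ-mod`. -/
def ContravariantlyFinite (Λ : Type u) [Ring Λ] : Prop :=
  ∀ M : ModuleCat.{u} Λ, Module.Finite Λ M →
    ∃ (A : ModuleCat.{u} Λ) (f : A →ₗ[Λ] M), IsRightApprox Λ M A f

/-- `P^∞(Λ-mod)` is covariantly finite in `Λ-mod`. -/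
def CovariantlyFinite (Λ : Type u) [Ring Λ] : Prop :=
  ∀ M : ModuleCat.{u} Λ, Module.Finite Λ M →
    ∃ (A : ModuleCat.{u} Λ) (f : M →ₗ[Λ] A), IsLeftApprox Λ M A f

/-- The projective dimension of a module, as an element of `ℕ∞` (`⊤` if infinite). -/
noncomputable def projDim (Λ : Type u) [Ring Λ] (M : ModuleCat.{u} Λ) : ℕ∞ :=
  sInf {d : ℕ∞ | ∃ n : ℕ, d = n ∧ HasProjDimLE Λ n M}

/-- The little finitistic dimension `l.findim Λ`. -/
noncomputable def finDimLittle (Λ : Type u) [Ring Λ] : ℕ∞ :=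
  ⨆ (M : ModuleCat.{u} Λ) (_ : Module.Finite Λ M ∧ HasFinProjDim Λ M), projDim Λ M

/-- The big finitistic dimension `l.Findim Λ`. -/
noncomputable def finDimBig (Λ : Type u) [Ring Λ] : ℕ∞ :=
  ⨆ (M : ModuleCat.{u} Λ) (_ : HasFinProjDim Λ M), projDim Λ M

/-- `M` is a direct limit of a directed system of finitely generated modules of finite
projective dimension. -/
def IsDirectLimitOfFGFinProjDim (Λ : Type u) [Ring Λ] (M : ModuleCat.{u} Λ) : Prop :=
  ∃ (ι : Type u) (_ : Preorder ι) (_ : DecidableEq ι), Nonempty ι ∧ IsDirected ι (· ≤ ·) ∧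
    ∃ (G : ι → ModuleCat.{u} Λ) (f : ∀ i j : ι, i ≤ j → G i →ₗ[Λ] G j),
      DirectedSystem (fun i => G i) (fun i j h => f i j h) ∧
      (∀ i, Module.Finite Λ (G i) ∧ HasFinProjDim Λ (G i)) ∧
      Nonempty ((Module.DirectLimit (fun i => G i) f) ≃ₗ[Λ] M)

/-- A finite-dimensional associative unital algebra over `K`, bundled. -/
structure FDAlg (K : Type u) [Field K] : Type (u + 1) where
  carrier : Type u
  [ringInst : Ring carrier]
  [algInst : Algebra K carrier]
  [fdInst : FiniteDimensional K carrier]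

attribute [instance] FDAlg.ringInst FDAlg.algInst FDAlg.fdInst

open TensorProduct

/-- `X` is a quotient of a finitely generated projective module by a projective submodule. -/
def HasFGProjPresentation (Λ : Type u) [Ring Λ] (X : Type u) [AddCommGroup X] [Module Λ X] :
    Prop :=
  ∃ (P : ModuleCat.{u} Λ) (g : P →ₗ[Λ] X), Module.Finite Λ P ∧ Module.Projective Λ P ∧
    Function.Surjective g ∧ Module.Projective Λ (LinearMap.ker g)

theorem HasFGProjPresentation.of_equiv {Λ : Type u} [Ring Λ] {X Y : Type u}
    [AddCommGroup X] [Module Λ X] [AddCommGroup Y] [Module Λ Y]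
    (h : HasFGProjPresentation Λ X) (e : X ≃ₗ[Λ] Y) : HasFGProjPresentation Λ Y := by
  obtain ⟨P, g, hfin, hproj, hg, hker⟩ := h
  refine ⟨P, e.toLinearMap ∘ₗ g, hfin, hproj, e.surjective.comp hg, ?_⟩
  rwa [LinearEquiv.ker_comp]

theorem HasFGProjPresentation.finite {Λ : Type u} [Ring Λ] {X : Type u}
    [AddCommGroup X] [Module Λ X] (h : HasFGProjPresentation Λ X) : Module.Finite Λ X := by
  obtain ⟨P, g, hfin, -, hg, -⟩ := h
  exact Module.Finite.of_surjective g hg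

theorem HasFGProjPresentation.hasProjDimLE_one {Λ : Type u} [Ring Λ] {X : Type u}
    [AddCommGroup X] [Module Λ X] (h : HasFGProjPresentation Λ X) :
    HasProjDimLE Λ 1 (ModuleCat.of Λ X) := by
  obtain ⟨P, g, -, hproj, hg, hker⟩ := h
  exact ⟨P, g, hproj, hg, hker⟩

/-- Every finitely generated submodule of a free module lies in a finitely generated projective
submodule. -/
theorem Submodule.FG.exists_le_projective {R F : Type*} [Ring R] [AddCommGroup F] [Module R F]
    [Module.Free R F] {N : Submodule R F} (hN : N.FG) :
    ∃ F' : Submodule R F, N ≤ F' ∧ F'.FG ∧ Module.Projective R F' := by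
  classical
  obtain ⟨s, rfl⟩ := hN
  let b := Module.Free.chooseBasis R F
  let T : Finset (Module.Free.ChooseBasisIndex R F) := s.biUnion fun x => (b.repr x).support
  let v : T → F := fun t => b t
  have hv : LinearIndependent R v := b.linearIndependent.comp _ Subtype.val_injective
  refine ⟨Submodule.span R (Set.range v), Submodule.span_le.2 fun x hx => ?_,
    Submodule.fg_span (Set.finite_range v),
    Module.Projective.of_basis (Module.Basis.span hv)⟩
  rw [SetLike.mem_coe, ← b.linearCombination_repr x, Finsupp.linearCombination_apply]
  refine Submodule.sum_mem _ fun i hi => Submodule.smul_mem _ _ (Submodule.subset_span ?_)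
  exact ⟨⟨i, Finset.mem_biUnion.2 ⟨x, hx, hi⟩⟩, rfl⟩

/-- A map from a finitely generated module to a module over the cokernel of an injection of free
modules factors through the cokernel of an injection of finitely generated projectives. -/
theorem exists_factorization_of_free {Λ : Type u} [Ring Λ] [IsNoetherianRing Λ]
    {M F G X : Type u} [AddCommGroup M] [Module Λ M] [AddCommGroup F] [Module Λ F]
    [AddCommGroup G] [Module Λ G] [AddCommGroup X] [Module Λ X]
    [Module.Free Λ F] [Module.Free Λ G]
    (Φ : G →ₗ[Λ] F) (hΦ : Function.Injective Φ) (ρ : F →ₗ[Λ] X) (hρΦ : ∀ x, ρ (Φ x) = 0)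
    (f : M →ₗ[Λ] X) {k : ℕ} (q : (Fin k → Λ) →ₗ[Λ] M) (hq : Function.Surjective q)
    (L : (Fin k → Λ) →ₗ[Λ] F) (hL : ∀ x, ρ (L x) = f (q x))
    (hLΦ : (LinearMap.ker q).map L ≤ LinearMap.range Φ) :
    ∃ (Y : ModuleCat.{u} Λ) (a : M →ₗ[Λ] Y) (c : Y →ₗ[Λ] X),
      HasFGProjPresentation Λ Y ∧ c ∘ₗ a = f := by
  have hmap : (((LinearMap.ker q).map L).comap Φ).map Φ = (LinearMap.ker q).map L := by
    rw [Submodule.map_comap_eq, inf_eq_right.2 hLΦ]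
  have hfg : (((LinearMap.ker q).map L).comap Φ).FG := by
    refine Submodule.fg_of_fg_map_injective Φ hΦ ?_
    rw [hmap]
    exact (IsNoetherian.noetherian (LinearMap.ker q)).map L
  obtain ⟨G', hG, hGfg, hGproj⟩ := hfg.exists_le_projective
  obtain ⟨F', hF, hFfg, hFproj⟩ := Submodule.FG.exists_le_projective
    ((hGfg.map Φ).sup (Submodule.FG.map L (IsNoetherian.noetherian ⊤)))
  have hGF : G'.map Φ ≤ F' := le_sup_left.trans hF
  have hLF (x) : L x ∈ F' := hF (Submodule.mem_sup_right ⟨x, trivial, rfl⟩)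
  let N : Submodule Λ F' := (G'.map Φ).submoduleOf F'
  let a₀ : (Fin k → Λ) →ₗ[Λ] F' ⧸ N := N.mkQ ∘ₗ L.codRestrict F' hLF
  have ha₀ : LinearMap.ker q ≤ LinearMap.ker a₀ := by
    intro x hx
    refine LinearMap.mem_ker.2 ((Submodule.Quotient.mk_eq_zero N).2 ?_)
    change L x ∈ G'.map Φ
    refine Submodule.map_mono hG ?_
    rw [hmap]
    exact ⟨x, hx, rfl⟩
  have hρ : N ≤ LinearMap.ker (ρ ∘ₗ F'.subtype) := by
    rintro x ⟨y, -, hy⟩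
    change ρ x = 0
    change Φ y = x at hy
    rw [← hy, hρΦ]
  let e := q.quotKerEquivOfSurjective hq
  refine ⟨ModuleCat.of Λ (F' ⧸ N), (LinearMap.ker q).liftQ a₀ ha₀ ∘ₗ e.symm.toLinearMap,
    N.liftQ _ hρ, ⟨ModuleCat.of Λ F', N.mkQ, Module.Finite.iff_fg.2 hFfg, hFproj,
      N.mkQ_surjective, ?_⟩, ?_⟩
  · rw [Submodule.ker_mkQ]
    exact Module.Projective.of_equiv
      ((Submodule.equivMapOfInjective Φ hΦ G').trans (Submodule.submoduleOfEquivOfLe hGF).symm)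
  · ext m
    obtain ⟨x, rfl⟩ := hq m
    have hx : e.symm (q x) = Submodule.Quotient.mk x := by
      rw [LinearEquiv.symm_apply_eq]
      rfl
    change N.liftQ _ hρ ((LinearMap.ker q).liftQ a₀ ha₀ (e.symm (q x))) = f (q x)
    rw [hx]
    exact hL x

/-- A map from a finitely generated module to a module of projective dimension at most one factors
through the cokernel of an injection of finitely generated projectives. -/
theorem exists_factorization_of_projective_ker {Λ : Type u} [Ring Λ] [IsNoetherianRing Λ]
    {M P X : Type u} [AddCommGroup M] [Module Λ M] [AddCommGroup P] [Module Λ P]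
    [AddCommGroup X] [Module Λ X] [Module.Finite Λ M] [Module.Projective Λ P]
    (g : P →ₗ[Λ] X) (hg : Function.Surjective g) [Module.Projective Λ (LinearMap.ker g)]
    (f : M →ₗ[Λ] X) :
    ∃ (Y : ModuleCat.{u} Λ) (a : M →ₗ[Λ] Y) (c : Y →ₗ[Λ] X),
      HasFGProjPresentation Λ Y ∧ c ∘ₗ a = f := by
  obtain ⟨j, hj⟩ := Module.projective_def'.1 (inferInstance : Module.Projective Λ P)
  obtain ⟨σ, hσ⟩ := Module.projective_def'.1
    (inferInstance : Module.Projective Λ (LinearMap.ker g))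
  set s := Finsupp.linearCombination Λ (id : P → P)
  set π := Finsupp.linearCombination Λ (id : LinearMap.ker g → LinearMap.ker g)
  have hj' (x : P) : s (j x) = x := LinearMap.congr_fun hj x
  have hσ' (x : LinearMap.ker g) : π (σ x) = x := LinearMap.congr_fun hσ x
  -- The cokernel of `Φ` is `X` up to direct summands, and both its source and target are free.
  let Φ : (LinearMap.ker g →₀ Λ) →ₗ[Λ] (P →₀ Λ) × (LinearMap.ker g →₀ Λ) :=
    (j ∘ₗ (LinearMap.ker g).subtype ∘ₗ π).prod (LinearMap.id - σ ∘ₗ π)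
  have hΦ : Function.Injective Φ := by
    rw [injective_iff_map_eq_zero]
    intro x hx
    have h1 : j (π x : P) = 0 := congrArg Prod.fst hx
    have h2 : x - σ (π x) = 0 := congrArg Prod.snd hx
    have h3 : π x = 0 := by
      apply Subtype.ext
      rw [← hj' (π x : P), h1, map_zero, Submodule.coe_zero]
    rwa [h3, map_zero, sub_zero] at h2
  obtain ⟨k, q, hq⟩ := Module.Finite.exists_fin' Λ M
  obtain ⟨l, hl⟩ := Module.projective_lifting_property g (f ∘ₗ q) hg
  have hl' (x) : g (l x) = f (q x) := LinearMap.congr_fun hl x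
  have hlker (x : LinearMap.ker q) : l x ∈ LinearMap.ker g := by
    rw [LinearMap.mem_ker, hl', LinearMap.mem_ker.1 x.2, map_zero]
  refine exists_factorization_of_free Φ hΦ (g ∘ₗ s ∘ₗ LinearMap.fst Λ _ _) (fun x => ?_) f q hq
    (LinearMap.inl Λ _ _ ∘ₗ j ∘ₗ l) (fun x => ?_) ?_
  · change g (s (j (π x : P))) = 0
    rw [hj']
    exact (π x).2
  · change g (s (j (l x))) = f (q x)
    rw [hj', hl']
  · rintro _ ⟨x, hx, rfl⟩
    let y : LinearMap.ker g := ⟨l x, hlker ⟨x, hx⟩⟩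
    refine ⟨σ y, ?_⟩
    change (j (π (σ y) : P), σ y - σ (π (σ y))) = (j (l x), 0)
    rw [hσ', sub_self]

/-- Arbitrary powers of a finite-dimensional algebra are free. -/
theorem Module.Free.function_of_finiteDimensional (K Λ J : Type*) [Field K] [Ring Λ]
    [Algebra K Λ] [FiniteDimensional K Λ] : Module.Free Λ (J → Λ) := by
  let B : Λ →ₗ[Λ] (J → K) →ₗ[K] (J → Λ) :=
    { toFun x := (LinearMap.toSpanSingleton K Λ x).compLeft J
      map_add' x y := by ext; simp
      map_smul' c x := by ext; simp }
  let h : Λ ⊗[K] (J → K) →ₗ[Λ] (J → Λ) := TensorProduct.AlgebraTensorModule.lift B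
  have h_tmul (x : Λ) (v : J → K) (i : J) : h (x ⊗ₜ v) i = v i • x := rfl
  let β := Module.finBasis K Λ
  let c : (J → Λ) →ₗ[K] Λ ⊗[K] (J → K) :=
    ∑ i, TensorProduct.mk K Λ (J → K) (β i) ∘ₗ (β.coord i).compLeft J
  have hc (x : J → Λ) : c x = ∑ i, β i ⊗ₜ[K] fun t => β.repr (x t) i := by
    simp only [c, LinearMap.sum_apply]
    rfl
  have hch : c ∘ₗ h.restrictScalars K = LinearMap.id := by
    refine TensorProduct.ext' fun x v => ?_
    change c (h (x ⊗ₜ v)) = x ⊗ₜ v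
    rw [hc]
    conv_rhs => rw [← β.sum_repr x, TensorProduct.sum_tmul]
    refine Finset.sum_congr rfl fun i _ => ?_
    rw [TensorProduct.smul_tmul]
    congr 1
    ext t
    simp [h_tmul, mul_comm]
  have hhc (x : J → Λ) : h (c x) = x := by
    rw [hc, map_sum]
    ext t
    rw [Finset.sum_apply]
    simp only [h_tmul]
    exact β.sum_repr (x t)
  have hbij : Function.Bijective h :=
    ⟨Function.LeftInverse.injective (g := c) (LinearMap.congr_fun hch),
      Function.RightInverse.surjective hhc⟩
  exact Module.Free.of_equiv (LinearEquiv.ofBijective h hbij)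

/-- Arbitrary products of finitely generated projective modules over a finite-dimensional algebra
are projective. -/
theorem Module.Projective.pi_of_finiteDimensional (K : Type*) {Λ I : Type*} [Field K] [Ring Λ]
    [Algebra K Λ] [FiniteDimensional K Λ] (P : I → Type*) [∀ i, AddCommGroup (P i)]
    [∀ i, Module Λ (P i)] (hfin : ∀ i, Module.Finite Λ (P i))
    (hproj : ∀ i, Module.Projective Λ (P i)) : Module.Projective Λ (∀ i, P i) := by
  choose n q hq using fun i => Module.Finite.exists_fin' Λ (P i)
  choose t ht using fun i => Module.projective_lifting_property (q i) LinearMap.id (hq i)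
  have : Module.Free Λ ((Σ i, Fin (n i)) → Λ) :=
    Module.Free.function_of_finiteDimensional K Λ _
  have : Module.Projective Λ (∀ i, Fin (n i) → Λ) :=
    Module.Projective.of_equiv
      (LinearEquiv.piCurry Λ (fun (i : I) (_ : Fin (n i)) => Λ))
  refine Module.Projective.of_split (LinearMap.piMap t) (LinearMap.piMap q) ?_
  ext x i
  exact LinearMap.congr_fun (ht i) (x i)

/-- Auslander–Reiten; Proposition 1.  If every finitely generated left
`Λ`-module of finite projective dimension has projective dimension at most `1`
(i.e. `l.findim Λ ≤ 1`), then `P^∞(Λ-mod)` is covariantly finite in `Λ-mod`: every finitely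
generated left `Λ`-module `M` admits a homomorphism `f : M → A` with `A` finitely generated of
finite projective dimension such that every homomorphism `g : M → B` into a finitely generated
module `B` of finite projective dimension factors as `g = h ∘ f`. -/
theorem findim_le_one_implies_covariantly_finite
    (K : Type u) (Λ : Type u) [Field K] [Ring Λ] [Algebra K Λ] [FiniteDimensional K Λ]
    (hfd : ∀ M : ModuleCat.{u} Λ, Module.Finite Λ M → HasFinProjDim Λ M →
      HasProjDimLE Λ 1 M) :
    ∀ M : ModuleCat.{u} Λ, Module.Finite Λ M →
      ∃ (A : ModuleCat.{u} Λ) (f : M →ₗ[Λ] A), IsLeftApprox Λ M A f := by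
  intro M hM
  have : IsNoetherianRing Λ := isNoetherian_of_tower K inferInstance
  let I := Σ i : (Σ n : ℕ, {N : Submodule Λ (Fin n → Λ) //
    HasFGProjPresentation Λ ((Fin n → Λ) ⧸ N)}), (M →ₗ[Λ] (Fin i.1 → Λ) ⧸ i.2.1)
  choose P g hfin hproj hg hker using fun i : I => i.1.2.2
  let G : (∀ i, P i) →ₗ[Λ] (∀ i : I, (Fin i.1.1 → Λ) ⧸ i.1.2.1) := LinearMap.piMap g
  have hG : Function.Surjective G := Function.Surjective.piMap hg
  have : Module.Projective Λ (∀ i, P i) :=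
    Module.Projective.pi_of_finiteDimensional K (fun i => P i) hfin hproj
  have : Module.Projective Λ (∀ i, LinearMap.ker (g i)) :=
    Module.Projective.pi_of_finiteDimensional K (fun i => LinearMap.ker (g i))
      (fun _ => inferInstance) hker
  let kerEquiv : (∀ i, LinearMap.ker (g i)) ≃ₗ[Λ] LinearMap.ker G :=
    { toFun x := ⟨fun i => x i, funext fun i => (x i).2⟩
      invFun x i := ⟨x.1 i, congrFun x.2 i⟩
      map_add' _ _ := rfl
      map_smul' _ _ := rfl
      left_inv _ := rfl
      right_inv _ := rfl }
  have : Module.Projective Λ (LinearMap.ker G) := Module.Projective.of_equiv kerEquiv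
  obtain ⟨A, f, c, hA, hcf⟩ := exists_factorization_of_projective_ker G hG
    (LinearMap.pi fun i : I => i.2)
  refine ⟨A, f, hA.finite, ⟨1, hA.hasProjDimLE_one⟩, fun B hBfin hB b => ?_⟩
  obtain ⟨Q, p, hQ, hp, hpker⟩ := hfd B hBfin hB
  have : Module.Projective Λ (LinearMap.ker p) := hpker
  obtain ⟨Y, a, d, hY, rfl⟩ := exists_factorization_of_projective_ker p hp b
  have := hY.finite
  obtain ⟨n, q, hq⟩ := Module.Finite.exists_fin' Λ Y
  let e := q.quotKerEquivOfSurjective hq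
  let i : I := ⟨⟨n, LinearMap.ker q, hY.of_equiv e.symm⟩, e.symm.toLinearMap ∘ₗ a⟩
  refine ⟨d ∘ₗ e.toLinearMap ∘ₗ LinearMap.proj i ∘ₗ c, ?_⟩
  ext m
  have hm : c (f m) i = e.symm (a m) := congrFun (LinearMap.congr_fun hcf m) i
  change d (e (c (f m) i)) = d (a m)
  rw [hm, e.apply_symm_apply]
end

section
/- Let K be a field and Λ a finite-dimensional associative unital K-algebra. If P^∞(Λ-mod) is contravariantly finite in Λ-mod, then P^∞(Λ-mod) is covariantly finite in Λ-mod; that is, if every finitely generated left Λ-module admits a right P^∞(Λ-mod)-approximation, then every finitely generated left Λ-module admits a left P^∞(Λ-mod)-approximation. -/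
universe u

section FiniteProjectiveDimension

open CategoryTheory

section Exactness

variable {R : Type u} [Ring R] {A B C X : Type u} [AddCommGroup A] [Module R A]
  [AddCommGroup B] [Module R B] [AddCommGroup C] [Module R C] [AddCommGroup X] [Module R X]

theorem exists_comp_eq_of_exact_of_injective {i : A →ₗ[R] B} {p : B →ₗ[R] C}
    (hi : Function.Injective i) (hip : Function.Exact i p) (s : X →ₗ[R] B) (hs : p ∘ₗ s = 0) :
    ∃ t : X →ₗ[R] A, i ∘ₗ t = s := by
  have h : ∀ x, s x ∈ LinearMap.range i := fun x ↦
    (hip (s x)).1 (by simpa using LinearMap.congr_fun hs x)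
  refine ⟨(LinearEquiv.ofInjective i hi).symm.toLinearMap ∘ₗ s.codRestrict _ h, ?_⟩
  ext x
  have := LinearEquiv.apply_symm_apply (LinearEquiv.ofInjective i hi) (s.codRestrict _ h x)
  exact congrArg Subtype.val this

theorem exists_comp_eq_of_exact_of_surjective {i : A →ₗ[R] B} {p : B →ₗ[R] C}
    (hp : Function.Surjective p) (hip : Function.Exact i p) (s : B →ₗ[R] X) (hs : s ∘ₗ i = 0) :
    ∃ t : C →ₗ[R] X, t ∘ₗ p = s := by
  have h : LinearMap.ker p ≤ LinearMap.ker s := fun b hb ↦ by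
    obtain ⟨a, rfl⟩ := (hip b).1 hb
    simpa using LinearMap.congr_fun hs a
  refine ⟨(LinearMap.ker p).liftQ s h ∘ₗ
    (p.quotKerEquivOfSurjective hp).symm.toLinearMap, ?_⟩
  ext b
  have : (p.quotKerEquivOfSurjective hp).symm (p b) = (LinearMap.ker p).mkQ b := by
    rw [LinearEquiv.symm_apply_eq]
    rfl
  simp [this]

theorem exact_mkQ_range (f : A →ₗ[R] B) :
    Function.Exact f (LinearMap.range f).mkQ := by
  rw [LinearMap.exact_iff, Submodule.ker_mkQ]

theorem exists_pushout {i : A →ₗ[R] B} {p : B →ₗ[R] C} (hi : Function.Injective i)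
    (hp : Function.Surjective p) (hip : Function.Exact i p) (a : A →ₗ[R] X) :
    ∃ (E : Type u) (_ : AddCommGroup E) (_ : Module R E) (i' : X →ₗ[R] E) (p' : E →ₗ[R] C)
      (j : B →ₗ[R] E), Function.Injective i' ∧ Function.Surjective p' ∧ Function.Exact i' p' ∧
        i' ∘ₗ a = j ∘ₗ i ∧
        ∀ (Y : Type u) [AddCommGroup Y] [Module R Y] (u : X →ₗ[R] Y) (v : B →ₗ[R] Y),
          u ∘ₗ a = v ∘ₗ i → ∃ w : E →ₗ[R] Y, w ∘ₗ i' = u ∧ w ∘ₗ j = v := by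
  let N := LinearMap.range (a.prod (-i))
  have hN : ∀ z : X × B, z ∈ N ↔ ∃ y, a y = z.1 ∧ -i y = z.2 := fun z ↦ by
    simp [N, LinearMap.mem_range, Prod.ext_iff]
  have hpi : ∀ y, p (i y) = 0 := fun y ↦ (hip _).2 ⟨y, rfl⟩
  have hker : N ≤ LinearMap.ker (p ∘ₗ LinearMap.snd R X B) := fun z hz ↦ by
    obtain ⟨y, -, h2⟩ := (hN z).1 hz
    simp [← h2, hpi]
  refine ⟨(X × B) ⧸ N, inferInstance, inferInstance, N.mkQ ∘ₗ LinearMap.inl R X B,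
    N.liftQ (p ∘ₗ LinearMap.snd R X B) hker, N.mkQ ∘ₗ LinearMap.inr R X B, ?_, ?_, ?_, ?_, ?_⟩
  · rw [← LinearMap.ker_eq_bot, LinearMap.ker_eq_bot']
    intro x hx
    obtain ⟨y, h1, h2⟩ := (hN (x, 0)).1 (by simpa using hx)
    have hy : y = 0 := hi (by simpa using h2)
    simpa [hy] using h1.symm
  · intro c
    obtain ⟨b, rfl⟩ := hp c
    exact ⟨N.mkQ (0, b), by simp⟩
  · intro e
    obtain ⟨⟨x, b⟩, rfl⟩ := N.mkQ_surjective e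
    constructor
    · intro h
      obtain ⟨y, rfl⟩ := (hip b).1 (by simpa using h)
      refine ⟨x + a y, ?_⟩
      refine (Submodule.Quotient.eq N).2 ((hN _).2 ⟨y, ?_, ?_⟩) <;> simp
    · rintro ⟨y, hy⟩
      rw [← hy]
      simp
  · ext y
    refine (Submodule.Quotient.eq N).2 ((hN _).2 ⟨y, ?_, ?_⟩) <;> simp
  · intro Y _ _ u v huv
    refine ⟨N.liftQ (u.coprod v) fun z hz ↦ ?_, ?_, ?_⟩
    · obtain ⟨y, h1, h2⟩ := (hN z).1 hz
      have := LinearMap.congr_fun huv y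
      simp only [LinearMap.comp_apply] at this
      simp [← h1, ← h2, this]
    · ext x; simp
    · ext x; simp

end Exactness

section ProjectiveDimension

variable (R : Type u) [Ring R]

/-- The bound on the projective dimension from Mathlib, for an unbundled module. -/
abbrev ProjDimLE (n : ℕ) (M : Type u) [AddCommGroup M] [Module R M] : Prop :=
  HasProjectiveDimensionLE (ModuleCat.of R M) n

theorem projDimLE_zero_iff (M : Type u) [AddCommGroup M] [Module R M] :
    ProjDimLE R 0 M ↔ Module.Projective R M := by
  rw [ProjDimLE, ← projective_iff_hasProjectiveDimensionLE_zero, ← IsProjective.iff_projective]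

theorem hasProjDimLE_iff (n : ℕ) (M : ModuleCat.{u} R) :
    HasProjDimLE R n M ↔ ProjDimLE R n M := by
  induction n generalizing M with
  | zero => exact (projDimLE_zero_iff R M).symm
  | succ n ih =>
    constructor
    · rintro ⟨P, g, hP, hg, hk⟩
      have : Projective P := (IsProjective.iff_projective P).1 hP
      exact ((LinearMap.shortExact_shortComplexKer hg).hasProjectiveDimensionLT_X₃_iff n this).2
        ((ih _).1 hk)
    · intro h
      have hP : Module.Projective R (M →₀ R) := inferInstance
      have hg := Finsupp.linearCombination_id_surjective R M
      have : Projective (ModuleCat.of R (M →₀ R)) := (IsProjective.iff_projective _).1 hP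
      exact ⟨ModuleCat.of R (M →₀ R), _, hP, hg, (ih _).2
        (((LinearMap.shortExact_shortComplexKer hg).hasProjectiveDimensionLT_X₃_iff n this).1 h)⟩

variable {R} {A B C : Type u} [AddCommGroup A] [Module R A]
  [AddCommGroup B] [Module R B] [AddCommGroup C] [Module R C]

theorem ProjDimLE.mono {m n : ℕ} (hmn : m ≤ n) (h : ProjDimLE R m A) : ProjDimLE R n A :=
  hasProjectiveDimensionLT_of_ge _ (m + 1) (n + 1) (by lia)

theorem ProjDimLE.of_projective [Module.Projective R A] (n : ℕ) : ProjDimLE R n A :=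
  ((projDimLE_zero_iff R A).2 inferInstance).mono n.zero_le

theorem ProjDimLE.of_retract {n : ℕ} (h : ProjDimLE R n B) (s : A →ₗ[R] B) (r : B →ₗ[R] A)
    (hrs : r ∘ₗ s = LinearMap.id) : ProjDimLE R n A :=
  let e : Retract (ModuleCat.of R A) (ModuleCat.of R B) :=
    { i := ModuleCat.ofHom s
      r := ModuleCat.ofHom r
      retract := by rw [← ModuleCat.ofHom_comp, hrs]; rfl }
  e.hasProjectiveDimensionLT (n + 1)

theorem shortExact_of_exact {i : A →ₗ[R] B} {p : B →ₗ[R] C} (hi : Function.Injective i)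
    (hp : Function.Surjective p) (hip : Function.Exact i p) :
    (ModuleCat.shortComplexOfCompEqZero i p hip.linearMap_comp_eq_zero).ShortExact :=
  ModuleCat.shortComplex_shortExact _ hip hi hp

section

variable {i : A →ₗ[R] B} {p : B →ₗ[R] C} {n : ℕ}

theorem ProjDimLE.middle (hi : Function.Injective i)
    (hp : Function.Surjective p) (hip : Function.Exact i p)
    (hA : ProjDimLE R n A) (hC : ProjDimLE R n C) : ProjDimLE R n B :=
  (shortExact_of_exact hi hp hip).hasProjectiveDimensionLT_X₂ (n + 1) hA hC

theorem ProjDimLE.left (hi : Function.Injective i)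
    (hp : Function.Surjective p) (hip : Function.Exact i p)
    (hB : ProjDimLE R n B) (hC : ProjDimLE R (n + 1) C) : ProjDimLE R n A :=
  (shortExact_of_exact hi hp hip).hasProjectiveDimensionLT_X₁ (n + 1) hB hC

theorem ProjDimLE.right (hi : Function.Injective i)
    (hp : Function.Surjective p) (hip : Function.Exact i p)
    (hA : ProjDimLE R n A) (hB : ProjDimLE R (n + 1) B) : ProjDimLE R (n + 1) C :=
  (shortExact_of_exact hi hp hip).hasProjectiveDimensionLT_X₃ (n + 1) hA hB

end

theorem ProjDimLE.pi {n : ℕ} (h : ProjDimLE R n A) (m : ℕ) : ProjDimLE R n (Fin m → A) := by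
  induction m with
  | zero => exact .of_projective n
  | succ m ih =>
    refine ProjDimLE.middle (i := LinearMap.single R (fun _ : Fin (m + 1) ↦ A) 0)
      (p := LinearMap.funLeft R A Fin.succ) 
      (fun x y hxy ↦ by simpa using congrFun hxy 0) ?_ ?_ h ih
    · exact LinearMap.funLeft_surjective_of_injective _ _ _ (Fin.succ_injective m)
    · intro x
      constructor
      · intro hx
        refine ⟨x 0, ?_⟩
        ext k
        refine Fin.cases ?_ (fun k ↦ ?_) k
        · simp
        · simpa using (congrFun hx k).symm
      · rintro ⟨y, rfl⟩
        ext k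
        simp [LinearMap.funLeft_apply]

variable (R A) in
/-- Finitely generated modules of finite projective dimension. -/
structure IsFinProj : Prop where
  finite : Module.Finite R A
  projDim : ∃ n, ProjDimLE R n A

theorem IsFinProj.of_projective [Module.Finite R A] [Module.Projective R A] : IsFinProj R A :=
  ⟨inferInstance, 0, .of_projective 0⟩

theorem IsFinProj.pi (h : IsFinProj R A) (m : ℕ) : IsFinProj R (Fin m → A) :=
  have := h.finite
  ⟨inferInstance, h.projDim.imp fun _ hn ↦ hn.pi m⟩

theorem IsFinProj.of_retract (h : IsFinProj R B) (s : A →ₗ[R] B) (r : B →ₗ[R] A)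
    (hrs : r ∘ₗ s = LinearMap.id) : IsFinProj R A :=
  have := h.finite
  ⟨.of_surjective r fun x ↦ ⟨s x, LinearMap.congr_fun hrs x⟩,
    h.projDim.imp fun _ hn ↦ hn.of_retract s r hrs⟩

theorem IsFinProj.middle {i : A →ₗ[R] B} {p : B →ₗ[R] C} (hi : Function.Injective i)
    (hp : Function.Surjective p) (hip : Function.Exact i p)
    (hA : IsFinProj R A) (hC : IsFinProj R C) : IsFinProj R B := by
  obtain ⟨_, m, hm⟩ := hA
  obtain ⟨_, n, hn⟩ := hC
  refine ⟨?_, max m n, .middle hi hp hip (hm.mono (by simp)) (hn.mono (by simp))⟩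
  have e := LinearMap.exact_iff.1 hip
  refine ⟨Submodule.fg_of_fg_map_of_fg_inf_ker p ?_ ?_⟩
  · rw [Submodule.map_top, LinearMap.range_eq_top.2 hp]
    exact Module.Finite.fg_top
  · rw [top_inf_eq, e, LinearMap.range_eq_map]
    exact Module.Finite.fg_top.map i

theorem IsFinProj.left [IsNoetherianRing R] {i : A →ₗ[R] B} {p : B →ₗ[R] C}
    (hi : Function.Injective i) (hp : Function.Surjective p) (hip : Function.Exact i p)
    (hB : IsFinProj R B) (hC : IsFinProj R C) : IsFinProj R A := by
  obtain ⟨_, m, hm⟩ := hB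
  obtain ⟨_, n, hn⟩ := hC
  exact ⟨.of_injective i hi, max m n, .left hi hp hip (hm.mono (by simp)) (hn.mono (by lia))⟩

theorem IsFinProj.right {i : A →ₗ[R] B} {p : B →ₗ[R] C} (hi : Function.Injective i)
    (hp : Function.Surjective p) (hip : Function.Exact i p)
    (hA : IsFinProj R A) (hB : IsFinProj R B) : IsFinProj R C := by
  obtain ⟨_, m, hm⟩ := hA
  obtain ⟨_, n, hn⟩ := hB
  exact ⟨.of_surjective p hp, max m n + 1,
    .right hi hp hip (hm.mono (by simp)) (hn.mono (by lia))⟩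

theorem IsFinProj.prod (hA : IsFinProj R A) (hB : IsFinProj R B) : IsFinProj R (A × B) :=
  .middle (i := LinearMap.inl R A B) (p := LinearMap.snd R A B) LinearMap.inl_injective
    LinearMap.snd_surjective .inl_snd hA hB

theorem IsFinProj.ker [IsNoetherianRing R] {p : A →ₗ[R] B} (hp : Function.Surjective p)
    (hA : IsFinProj R A) (hB : IsFinProj R B) : IsFinProj R (LinearMap.ker p) :=
  .left (LinearMap.ker p).injective_subtype hp (LinearMap.exact_subtype_ker_map p) hA hB

end ProjectiveDimension

section UniformBound

variable {R : Type u} [Ring R] [IsArtinianRing R]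

theorem exists_split_jacobson_quotient (S : Type u) [AddCommGroup S] [Module R S]
    [IsSimpleModule R S] :
    ∃ (σ : S →ₗ[R] (R ⧸ Module.jacobson R R)) (τ : (R ⧸ Module.jacobson R R) →ₗ[R] S),
      τ ∘ₗ σ = LinearMap.id := by
  have : IsSemisimpleModule R (R ⧸ Module.jacobson R R) :=
    (IsArtinian.isSemisimpleModule_iff_jacobson R _).2 (Module.jacobson_quotient_jacobson R R)
  have : Nontrivial S := IsSimpleModule.nontrivial R S
  obtain ⟨s, hs⟩ := exists_ne (0 : S)
  have hle : Module.jacobson R R ≤ LinearMap.ker (LinearMap.toSpanSingleton R S s) := by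
    rw [← Submodule.comap_bot, ← IsSimpleModule.jacobson_eq_bot R S]
    exact Module.le_comap_jacobson _
  obtain ⟨σ, hσ⟩ := IsSemisimpleModule.lifting_property
    ((Module.jacobson R R).liftQ (LinearMap.toSpanSingleton R S s) hle) (fun x ↦ by
      obtain ⟨r, hr⟩ := IsSimpleModule.toSpanSingleton_surjective R hs x
      exact ⟨(Module.jacobson R R).mkQ r, hr⟩) LinearMap.id
  exact ⟨σ, _, hσ⟩

theorem exists_factorization_projDimLE {A : Type u} [AddCommGroup A] [Module R A]
    (hA : IsFinProj R A) {d : ℕ} (hd : ProjDimLE R d A) (f : A →ₗ[R] (R ⧸ Module.jacobson R R))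
    (hf : ∀ (B : Type u) [AddCommGroup B] [Module R B], IsFinProj R B →
      ∀ g : B →ₗ[R] (R ⧸ Module.jacobson R R), ∃ h : B →ₗ[R] A, f ∘ₗ h = g)
    {X : Type u} [AddCommGroup X] [Module R X] (hX : IsFiniteLength R X)
    (B : Type u) [AddCommGroup B] [Module R B] (hB : IsFinProj R B) (g : B →ₗ[R] X) :
    ∃ (D : Type u) (_ : AddCommGroup D) (_ : Module R D) (a : B →ₗ[R] D) (b : D →ₗ[R] X),
      ProjDimLE R d D ∧ b ∘ₗ a = g := by
  induction hX generalizing B with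
  | of_subsingleton =>
    exact ⟨PUnit, inferInstance, inferInstance, 0, 0, .of_projective d, Subsingleton.elim _ _⟩
  | @of_simple_quotient X _ _ N _ _ ih =>
    obtain ⟨σ, τ, hτσ⟩ := exists_split_jacobson_quotient (R := R) (X ⧸ N)
    obtain ⟨h, hh⟩ := hf B hB (σ ∘ₗ N.mkQ ∘ₗ g)
    have := hA.finite
    obtain ⟨n, p, hp⟩ := Module.Finite.exists_fin' R A
    obtain ⟨l, hl⟩ := Module.projective_lifting_property N.mkQ (τ ∘ₗ f ∘ₗ p) N.mkQ_surjective
    have hq : Function.Surjective (h.coprod p) := fun x ↦ by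
      obtain ⟨y, rfl⟩ := hp x
      exact ⟨(0, y), by simp⟩
    have hv : N.mkQ ∘ₗ g.coprod l = τ ∘ₗ f ∘ₗ h.coprod p := by
      rw [LinearMap.comp_coprod, LinearMap.comp_coprod, LinearMap.comp_coprod, hl, hh,
        ← LinearMap.comp_assoc _ σ, hτσ, LinearMap.id_comp]
    have hK := (hB.prod (.of_projective (R := R) (A := Fin n → R))).ker hq hA
    have hk := LinearMap.exact_subtype_ker_map (h.coprod p)
    obtain ⟨t, ht⟩ := exists_comp_eq_of_exact_of_injective N.injective_subtype
      (LinearMap.exact_subtype_mkQ N) (g.coprod l ∘ₗ (LinearMap.ker (h.coprod p)).subtype) (by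
        rw [← LinearMap.comp_assoc, hv, LinearMap.comp_assoc, LinearMap.comp_assoc,
          hk.linearMap_comp_eq_zero, LinearMap.comp_zero, LinearMap.comp_zero])
    obtain ⟨D', _, _, a₀, b₀, hD', hab⟩ := ih _ hK t
    obtain ⟨E, _, _, i', p', j, hi', hp', hip', -, huniv⟩ :=
      exists_pushout (LinearMap.ker (h.coprod p)).injective_subtype hq hk a₀
    obtain ⟨w, -, hw⟩ := huniv X (N.subtype ∘ₗ b₀) (g.coprod l) (by
      rw [LinearMap.comp_assoc, hab, ht])
    refine ⟨E, _, _, j ∘ₗ LinearMap.inl R B _, w, hD'.middle hi' hp' hip' hd, ?_⟩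
    rw [← LinearMap.comp_assoc, hw, LinearMap.coprod_inl]

end UniformBound

section RelativeInjective

variable {R : Type u} [Ring R]

variable (R) in
/-- Lifting along epimorphisms with kernel `A`, that is, the vanishing of `Ext¹(X, A)`. -/
def LiftsAlong (X A : Type u) [AddCommGroup X] [Module R X] [AddCommGroup A] [Module R A] : Prop :=
  ∀ (U V : Type u) [AddCommGroup U] [Module R U] [AddCommGroup V] [Module R V]
    (e : A →ₗ[R] U) (g : U →ₗ[R] V), Function.Injective e → Function.Surjective g →
      Function.Exact e g → ∀ φ : X →ₗ[R] V, ∃ ψ : X →ₗ[R] U, g ∘ₗ ψ = φ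

variable (R) in
/-- Injectivity relative to the monomorphisms with cokernel finitely generated of finite
projective dimension. -/
def IsRelInjective (T : Type u) [AddCommGroup T] [Module R T] : Prop :=
  ∀ (A B C : Type u) [AddCommGroup A] [Module R A] [AddCommGroup B] [Module R B]
    [AddCommGroup C] [Module R C] (i : A →ₗ[R] B) (p : B →ₗ[R] C), Function.Injective i →
      Function.Surjective p → Function.Exact i p → IsFinProj R C →
        ∀ a : A →ₗ[R] T, ∃ b : B →ₗ[R] T, b ∘ₗ i = a

theorem IsRelInjective.pi {T : Type u} [AddCommGroup T] [Module R T] (hT : IsRelInjective R T)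
    (m : ℕ) : IsRelInjective R (Fin m → T) := by
  intro A B C _ _ _ _ _ _ i p hi hp hip hC a
  choose b hb using fun k ↦ hT A B C i p hi hp hip hC (LinearMap.proj k ∘ₗ a)
  refine ⟨LinearMap.pi b, ?_⟩
  ext x k
  exact LinearMap.congr_fun (hb k) x

theorem isRelInjective_of_retracts {T : Type u} [AddCommGroup T] [Module R T]
    (hT : IsFinProj R T)
    (h : ∀ (E : Type u) [AddCommGroup E] [Module R E] (i : T →ₗ[R] E), IsFinProj R E →
      Function.Injective i → ∃ r : E →ₗ[R] T, r ∘ₗ i = LinearMap.id) :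
    IsRelInjective R T := by
  intro A B C _ _ _ _ _ _ i p hi hp hip hC a
  obtain ⟨E, _, _, i', p', j, hi', hp', hip', hcomm, -⟩ := exists_pushout hi hp hip a
  obtain ⟨r, hr⟩ := h E i' (hT.middle hi' hp' hip' hC) hi'
  exact ⟨r ∘ₗ j, by rw [LinearMap.comp_assoc, ← hcomm, ← LinearMap.comp_assoc, hr,
    LinearMap.id_comp]⟩

theorem liftsAlong_of_extension {X A P K : Type u} [AddCommGroup X] [Module R X] [AddCommGroup A]
    [Module R A] [AddCommGroup P] [Module R P] [AddCommGroup K] [Module R K]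
    [Module.Projective R P] {k : K →ₗ[R] P} {p : P →ₗ[R] X}
    (hp : Function.Surjective p) (hkp : Function.Exact k p)
    (h : ∀ t : K →ₗ[R] A, ∃ t' : P →ₗ[R] A, t' ∘ₗ k = t) : LiftsAlong R X A := by
  intro U V _ _ _ _ e g he hg heg φ
  obtain ⟨s, hs⟩ := Module.projective_lifting_property g (φ ∘ₗ p) hg
  obtain ⟨t, ht⟩ := exists_comp_eq_of_exact_of_injective he heg (s ∘ₗ k) (by
    rw [← LinearMap.comp_assoc, hs, LinearMap.comp_assoc, hkp.linearMap_comp_eq_zero,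
      LinearMap.comp_zero])
  obtain ⟨t', ht'⟩ := h t
  obtain ⟨ψ, hψ⟩ := exists_comp_eq_of_exact_of_surjective hp hkp (s - e ∘ₗ t') (by
    rw [LinearMap.sub_comp, LinearMap.comp_assoc, ht', ht, sub_self])
  refine ⟨ψ, (LinearMap.cancel_right hp).1 ?_⟩
  rw [LinearMap.comp_assoc, hψ, LinearMap.comp_sub, hs, ← LinearMap.comp_assoc,
    heg.linearMap_comp_eq_zero, LinearMap.zero_comp, sub_zero]

theorem liftsAlong_of_projective {X A : Type u} [AddCommGroup X] [Module R X] [AddCommGroup A]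
    [Module R A] [Module.Projective R X] : LiftsAlong R X A :=
  fun _ _ _ _ _ _ _ g _ hg _ φ ↦ Module.projective_lifting_property g φ hg

variable (R) in
/-- `Ext¹(X, A) = 0` for all finitely generated `X` of projective dimension at most `j`. -/
def LiftsLE (j : ℕ) (A : Type u) [AddCommGroup A] [Module R A] : Prop :=
  ∀ (X : Type u) [AddCommGroup X] [Module R X], IsFinProj R X → ProjDimLE R j X →
    LiftsAlong R X A

theorem liftsLE_zero (A : Type u) [AddCommGroup A] [Module R A] : LiftsLE R 0 A :=
  fun X _ _ _ hX ↦ have := (projDimLE_zero_iff R X).1 hX; liftsAlong_of_projective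

theorem LiftsLE.succ [IsNoetherianRing R] {A T A' : Type u} [AddCommGroup A] [Module R A]
    [AddCommGroup T] [Module R T] [AddCommGroup A'] [Module R A'] {j : ℕ} (hA : LiftsLE R j A)
    (hT : IsRelInjective R T) {i : A →ₗ[R] T} {q : T →ₗ[R] A'} (hi : Function.Injective i)
    (hq : Function.Surjective q) (hiq : Function.Exact i q) : LiftsLE R (j + 1) A' := by
  intro X _ _ hX hXj
  have := hX.finite
  obtain ⟨n, p, hp⟩ := Module.Finite.exists_fin' R X
  have hk := LinearMap.exact_subtype_ker_map p
  have hki := (LinearMap.ker p).injective_subtype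
  refine liftsAlong_of_extension hp hk fun t ↦ ?_
  obtain ⟨s, hs⟩ := hA (LinearMap.ker p) (.ker hp .of_projective hX)
    (.left hki hp hk (.of_projective j) hXj) T A' i q hi hq hiq t
  obtain ⟨s', hs'⟩ := hT _ _ _ _ _ hki hp hk hX s
  exact ⟨q ∘ₗ s', by rw [LinearMap.comp_assoc, hs', hs]⟩

end RelativeInjective

section Coresolution

variable (R : Type u) [Ring R] (T : Type u) [AddCommGroup T] [Module R T]

/-- Modules with a coresolution of length at most `k` by finite powers of `T`, up to a direct
summand in the last term. -/
def HasCoresolution : ℕ → ∀ (B : Type u) [AddCommGroup B] [Module R B], Prop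
  | 0, B, _, _ => ∃ (m : ℕ) (s : B →ₗ[R] (Fin m → T)) (r : (Fin m → T) →ₗ[R] B),
      r ∘ₗ s = LinearMap.id
  | k + 1, B, _, _ => ∃ (m : ℕ) (c : B →ₗ[R] (Fin m → T)), Function.Injective c ∧
      HasCoresolution k ((Fin m → T) ⧸ LinearMap.range c)

variable {R T}

theorem hasCoresolution_of_liftsLE [IsNoetherianRing R] {d : ℕ} (hT : IsFinProj R T)
    (hT' : IsRelInjective R T)
    (hd : ∀ (B : Type u) [AddCommGroup B] [Module R B], IsFinProj R B → ProjDimLE R d B)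
    (hemb : ∀ (B : Type u) [AddCommGroup B] [Module R B], IsFinProj R B →
      ∃ (m : ℕ) (c : B →ₗ[R] (Fin m → T)), Function.Injective c)
    (k j : ℕ) (hkj : j + k = d) (B : Type u) [AddCommGroup B] [Module R B] (hB : IsFinProj R B)
    (hBj : LiftsLE R j B) : HasCoresolution R T k B := by
  induction k generalizing j B with
  | zero =>
    obtain rfl : j = d := hkj
    obtain ⟨m, c, hc⟩ := hemb B hB
    have hQ := hB.right hc (Submodule.mkQ_surjective _) (exact_mkQ_range c) (hT.pi m)
    obtain ⟨ψ, hψ⟩ := hBj _ hQ (hd _ hQ) _ _ c _ hc (Submodule.mkQ_surjective _)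
      (exact_mkQ_range c) LinearMap.id
    obtain ⟨r, hr⟩ := exists_comp_eq_of_exact_of_injective hc (exact_mkQ_range c)
      (LinearMap.id - ψ ∘ₗ (LinearMap.range c).mkQ) (by
        rw [LinearMap.comp_sub, ← LinearMap.comp_assoc, hψ, LinearMap.comp_id,
          LinearMap.id_comp, sub_self])
    refine ⟨m, c, r, (LinearMap.cancel_left hc).1 ?_⟩
    rw [← LinearMap.comp_assoc, hr, LinearMap.sub_comp, LinearMap.comp_assoc,
      (exact_mkQ_range c).linearMap_comp_eq_zero, LinearMap.comp_zero, sub_zero,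
      LinearMap.id_comp, LinearMap.comp_id]
  | succ k ih =>
    obtain ⟨m, c, hc⟩ := hemb B hB
    exact ⟨m, c, hc, ih (j + 1) (by lia) _
      (hB.right hc (Submodule.mkQ_surjective _) (exact_mkQ_range c) (hT.pi m))
      (hBj.succ (hT'.pi m) hc (Submodule.mkQ_surjective _) (exact_mkQ_range c))⟩

theorem exists_leftApprox_hasCoresolution [IsNoetherianRing R] (hT : IsFinProj R T)
    (happrox : ∀ (M : Type u) [AddCommGroup M] [Module R M], Module.Finite R M →
      ∃ (n : ℕ) (f : M →ₗ[R] (Fin n → T)), ∀ g : M →ₗ[R] T,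
        ∃ h : (Fin n → T) →ₗ[R] T, h ∘ₗ f = g)
    (k : ℕ) (M : Type u) [AddCommGroup M] [Module R M] (hM : Module.Finite R M) :
    ∃ (A : Type u) (_ : AddCommGroup A) (_ : Module R A) (f : M →ₗ[R] A), IsFinProj R A ∧
      ∀ (B : Type u) [AddCommGroup B] [Module R B], HasCoresolution R T k B →
        ∀ g : M →ₗ[R] B, ∃ h : A →ₗ[R] B, h ∘ₗ f = g := by
  have hpow : ∀ (M : Type u) [AddCommGroup M] [Module R M], Module.Finite R M →
      ∃ (n : ℕ) (f : M →ₗ[R] (Fin n → T)), ∀ (m : ℕ) (g : M →ₗ[R] (Fin m → T)),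
        ∃ h : (Fin n → T) →ₗ[R] (Fin m → T), h ∘ₗ f = g := fun M _ _ hM ↦ by
    obtain ⟨n, f, hf⟩ := happrox M hM
    refine ⟨n, f, fun m g ↦ ?_⟩
    choose h hh using fun a ↦ hf (LinearMap.proj a ∘ₗ g)
    refine ⟨LinearMap.pi h, ?_⟩
    ext x a
    exact LinearMap.congr_fun (hh a) x
  induction k generalizing M with
  | zero =>
    obtain ⟨n, f, hf'⟩ := hpow M hM
    refine ⟨Fin n → T, inferInstance, inferInstance, f, hT.pi n, ?_⟩
    intro B _ _ ⟨m, s, r, hrs⟩ g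
    obtain ⟨h, hh⟩ := hf' m (s ∘ₗ g)
    exact ⟨r ∘ₗ h, by rw [LinearMap.comp_assoc, hh, ← LinearMap.comp_assoc, hrs,
      LinearMap.id_comp]⟩
  | succ k ih =>
    obtain ⟨n, f, hf'⟩ := hpow M hM
    have := (hT.pi n).finite
    obtain ⟨A, _, _, f₁, hA, hf₁⟩ := ih ((Fin n → T) ⧸ LinearMap.range f) inferInstance
    have := hA.finite
    obtain ⟨l, p, hp⟩ := Module.Finite.exists_fin' R A
    let q := (f₁ ∘ₗ (LinearMap.range f).mkQ).coprod p
    have hq : Function.Surjective q := fun x ↦ by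
      obtain ⟨y, rfl⟩ := hp x
      exact ⟨(0, y), by simp [q]⟩
    have hk := LinearMap.exact_subtype_ker_map q
    obtain ⟨a, ha⟩ := exists_comp_eq_of_exact_of_injective (LinearMap.ker q).injective_subtype hk
      (LinearMap.inl R _ _ ∘ₗ f) (by
        rw [← LinearMap.comp_assoc, LinearMap.coprod_inl, LinearMap.comp_assoc,
          (exact_mkQ_range f).linearMap_comp_eq_zero, LinearMap.comp_zero])
    refine ⟨LinearMap.ker q, inferInstance, inferInstance, a,
    ((hT.pi n).prod .of_projective).ker hq hA, ?_⟩
    intro B _ _ ⟨m, c, hc, hQ⟩ g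
    obtain ⟨h₀, hh₀⟩ := hf' m (c ∘ₗ g)
    obtain ⟨m₁, hm₁⟩ := exists_comp_eq_of_exact_of_surjective (Submodule.mkQ_surjective _)
      (exact_mkQ_range f) ((LinearMap.range c).mkQ ∘ₗ h₀) (by
        rw [LinearMap.comp_assoc, hh₀, ← LinearMap.comp_assoc,
          (exact_mkQ_range c).linearMap_comp_eq_zero, LinearMap.zero_comp])
    obtain ⟨h₁, hh₁⟩ := hf₁ _ hQ m₁
    obtain ⟨l', hl'⟩ := Module.projective_lifting_property (LinearMap.range c).mkQ (h₁ ∘ₗ p)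
      (Submodule.mkQ_surjective _)
    have hv : (LinearMap.range c).mkQ ∘ₗ h₀.coprod l' = h₁ ∘ₗ q := by
      rw [LinearMap.comp_coprod, LinearMap.comp_coprod, hl', ← LinearMap.comp_assoc _ f₁, hh₁,
        hm₁]
    obtain ⟨t, ht⟩ := exists_comp_eq_of_exact_of_injective hc (exact_mkQ_range c)
      (h₀.coprod l' ∘ₗ (LinearMap.ker q).subtype) (by
        rw [← LinearMap.comp_assoc, hv, LinearMap.comp_assoc, hk.linearMap_comp_eq_zero,
          LinearMap.comp_zero])
    refine ⟨t, (LinearMap.cancel_left hc).1 ?_⟩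
    rw [← LinearMap.comp_assoc, ht, LinearMap.comp_assoc, ha, ← LinearMap.comp_assoc,
      LinearMap.coprod_inl, hh₀]

end Coresolution

section RightApproximation

variable {R : Type u} [Ring R]

/-- Right approximations by finitely generated modules of finite projective dimension, for
unbundled modules. -/
structure IsFinProjCover {M A : Type u} [AddCommGroup M] [Module R M] [AddCommGroup A]
    [Module R A] (f : A →ₗ[R] M) : Prop where
  isFinProj : IsFinProj R A
  exists_lift : ∀ (B : Type u) [AddCommGroup B] [Module R B], IsFinProj R B →
    ∀ g : B →ₗ[R] M, ∃ h : B →ₗ[R] A, f ∘ₗ h = g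

theorem ContravariantlyFinite.exists_isFinProjCover (h : ContravariantlyFinite R) (M : Type u)
    [AddCommGroup M] [Module R M] [hM : Module.Finite R M] :
    ∃ (A : Type u) (_ : AddCommGroup A) (_ : Module R A) (f : A →ₗ[R] M), IsFinProjCover f := by
  obtain ⟨A, f, hA, ⟨n, hn⟩, hf⟩ := h (ModuleCat.of R M) hM
  exact ⟨A, inferInstance, inferInstance, f, ⟨hA, n, (hasProjDimLE_iff R n A).1 hn⟩,
    fun B _ _ hB g ↦ hf (ModuleCat.of R B) hB.finite
      (hB.projDim.imp fun n hn ↦ (hasProjDimLE_iff R n _).2 hn) g⟩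

theorem exists_minimal_isFinProjCover [IsArtinianRing R] {M A : Type u} [AddCommGroup M]
    [Module R M] [AddCommGroup A] [Module R A] {f : A →ₗ[R] M} (hf : IsFinProjCover f) :
    ∃ (T : Type u) (_ : AddCommGroup T) (_ : Module R T) (f : T →ₗ[R] M), IsFinProjCover f ∧
      ∀ φ : T →ₗ[R] T, f ∘ₗ φ = f → Function.Bijective φ := by
  let S : Set ℕ∞ := {n | ∃ (T : Type u) (_ : AddCommGroup T) (_ : Module R T) (f : T →ₗ[R] M),
    IsFinProjCover f ∧ Module.length R T = n}
  obtain ⟨n, ⟨T, _, _, f, hf, rfl⟩, hmin⟩ :=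
    wellFounded_lt.has_min S ⟨_, A, _, _, f, hf, rfl⟩
  refine ⟨T, _, _, f, hf, fun φ hφ ↦ ?_⟩
  have := hf.isFinProj.finite
  have hpow : ∀ k : ℕ, f ∘ₗ φ ^ k = f := fun k ↦ by
    induction k with
    | zero => rfl
    | succ k ih => rw [pow_succ, Module.End.mul_eq_comp, ← LinearMap.comp_assoc, ih, hφ]
  obtain ⟨k, hc, hk⟩ := ((LinearMap.eventually_isCompl_ker_pow_range_pow φ).and
    (Filter.eventually_ge_atTop 1)).exists
  have hcover : IsFinProjCover (f ∘ₗ (LinearMap.range (φ ^ k)).subtype) := by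
    refine ⟨hf.isFinProj.of_retract _ _ (Submodule.projectionOnto_comp_subtype hc.symm),
      fun B _ _ hB g ↦ ?_⟩
    obtain ⟨h, hh⟩ := hf.exists_lift B hB g
    refine ⟨(φ ^ k).rangeRestrict ∘ₗ h, ?_⟩
    rw [← hh, ← LinearMap.comp_assoc]
    exact congrArg (· ∘ₗ h) (hpow k)
  have htop : LinearMap.range (φ ^ k) = ⊤ := by
    by_contra hne
    exact hmin _ ⟨_, _, _, _, hcover, rfl⟩ (Submodule.length_lt hne)
  have hbot : LinearMap.ker (φ ^ k) = ⊥ := by simpa [htop] using hc.disjoint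
  obtain ⟨l, rfl⟩ := Nat.exists_eq_add_of_le' hk
  constructor
  · have := LinearMap.ker_eq_bot.1 hbot
    rw [pow_succ, Module.End.mul_eq_comp] at this
    exact Function.Injective.of_comp this
  · have := LinearMap.range_eq_top.1 htop
    rw [pow_succ', Module.End.mul_eq_comp] at this
    exact Function.Surjective.of_comp this

theorem ContravariantlyFinite.exists_projDimLE [IsArtinianRing R] (h : ContravariantlyFinite R) :
    ∃ d : ℕ, ∀ (B : Type u) [AddCommGroup B] [Module R B], IsFinProj R B → ProjDimLE R d B := by
  obtain ⟨A, _, _, f, hf⟩ := h.exists_isFinProjCover (R ⧸ Module.jacobson R R)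
  obtain ⟨d, hd⟩ := hf.isFinProj.projDim
  refine ⟨d, fun B _ _ hB ↦ ?_⟩
  have := hB.finite
  obtain ⟨D, _, _, a, b, hD, hab⟩ := exists_factorization_projDimLE hf.isFinProj hd f
    hf.exists_lift (isFiniteLength_iff_isNoetherian_isArtinian.2 ⟨inferInstance, inferInstance⟩)
    B hB LinearMap.id
  exact hD.of_retract a b hab

theorem IsFinProjCover.isRelInjective {I T : Type u} [AddCommGroup I] [Module R I]
    [AddCommGroup T] [Module R T] {f : T →ₗ[R] I} (hf : IsFinProjCover f)
    (hmin : ∀ φ : T →ₗ[R] T, f ∘ₗ φ = f → Function.Bijective φ)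
    (hI : ∀ (A B : Type u) [AddCommGroup A] [Module R A] [AddCommGroup B] [Module R B]
      (i : A →ₗ[R] B) (a : A →ₗ[R] I), Function.Injective i → ∃ b : B →ₗ[R] I, b ∘ₗ i = a) :
    IsRelInjective R T := by
  refine isRelInjective_of_retracts hf.isFinProj fun E _ _ i hE hi ↦ ?_
  obtain ⟨g, hg⟩ := hI T E i f hi
  obtain ⟨h, hh⟩ := hf.exists_lift E hE g
  have hb := hmin (h ∘ₗ i) (by rw [← LinearMap.comp_assoc, hh, hg])
  refine ⟨(LinearEquiv.ofBijective (h ∘ₗ i) hb).symm.toLinearMap ∘ₗ h, ?_⟩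
  ext x
  exact (LinearEquiv.ofBijective (h ∘ₗ i) hb).symm_apply_apply x

end RightApproximation

section Dual

/-- The `K`-dual of the right regular module of `Λ`, an injective cogenerator. -/
def DualRegular (K Λ : Type u) [Field K] [Ring Λ] [Algebra K Λ] : Type u := Λ →ₗ[K] K

namespace DualRegular

variable {K Λ : Type u} [Field K] [Ring Λ] [Algebra K Λ]

instance : AddCommGroup (DualRegular K Λ) := inferInstanceAs (AddCommGroup (Λ →ₗ[K] K))

instance : Module K (DualRegular K Λ) := inferInstanceAs (Module K (Λ →ₗ[K] K))

/-- Evaluation of an element of the dual. -/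
def eval (f : DualRegular K Λ) : Λ →ₗ[K] K := f

theorem ext {f g : DualRegular K Λ} (h : ∀ x, eval f x = eval g x) : f = g := LinearMap.ext h

theorem eval_add (f g : DualRegular K Λ) (x : Λ) : eval (f + g) x = eval f x + eval g x := rfl

theorem eval_zero (x : Λ) : eval (0 : DualRegular K Λ) x = 0 := rfl

theorem eval_base_smul (c : K) (f : DualRegular K Λ) (x : Λ) : eval (c • f) x = c • eval f x := rfl

instance : SMul Λ (DualRegular K Λ) where
  smul a f := eval f ∘ₗ LinearMap.mulRight K a

theorem eval_smul (a : Λ) (f : DualRegular K Λ) (x : Λ) : eval (a • f) x = eval f (x * a) := rfl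

instance : Module Λ (DualRegular K Λ) where
  one_smul f := ext fun x ↦ by rw [eval_smul, mul_one]
  mul_smul a b f := ext fun x ↦ by rw [eval_smul, eval_smul, eval_smul, mul_assoc]
  smul_zero a := ext fun x ↦ by rw [eval_smul, eval_zero, eval_zero]
  smul_add a f g := ext fun x ↦ by simp only [eval_smul, eval_add]
  add_smul a b f := ext fun x ↦ by simp only [eval_smul, eval_add, mul_add, map_add]
  zero_smul f := ext fun x ↦ by rw [eval_smul, eval_zero, mul_zero, map_zero]

instance : IsScalarTower K Λ (DualRegular K Λ) where
  smul_assoc c a f := ext fun x ↦ by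
    rw [eval_base_smul, eval_smul, eval_smul, mul_smul_comm, map_smul]

instance [FiniteDimensional K Λ] : Module.Finite Λ (DualRegular K Λ) :=
  have : Module.Finite K (DualRegular K Λ) := inferInstanceAs (Module.Finite K (Λ →ₗ[K] K))
  .of_restrictScalars_finite K Λ _

section

variable {M : Type u} [AddCommGroup M] [Module K M] [Module Λ M] [IsScalarTower K Λ M]

/-- The `Λ`-linear map into the dual induced by a `K`-linear functional. -/
def ofFunctional (ψ : M →ₗ[K] K) : M →ₗ[Λ] DualRegular K Λ where
  toFun m := ψ ∘ₗ (LinearMap.toSpanSingleton Λ M m).restrictScalars K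
  map_add' m n := LinearMap.ext fun x ↦
    (congrArg ψ (smul_add x m n)).trans (map_add ψ _ _)
  map_smul' a m := ext fun x ↦ congrArg ψ (smul_smul x a m)

theorem eval_ofFunctional (ψ : M →ₗ[K] K) (m : M) (x : Λ) :
    eval (ofFunctional (Λ := Λ) ψ m) x = ψ (x • m) := rfl

/-- The `K`-linear functional obtained by evaluation at `1`. -/
def toFunctional (f : M →ₗ[Λ] DualRegular K Λ) : M →ₗ[K] K where
  toFun m := eval (f m) 1
  map_add' m n := by rw [map_add]; rfl
  map_smul' c m := by rw [LinearMap.map_smul_of_tower]; rfl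

end

theorem exists_extension (A B : Type u) [AddCommGroup A] [Module Λ A] [AddCommGroup B]
    [Module Λ B] (i : A →ₗ[Λ] B) (a : A →ₗ[Λ] DualRegular K Λ) (hi : Function.Injective i) :
    ∃ b : B →ₗ[Λ] DualRegular K Λ, b ∘ₗ i = a := by
  let _ : Module K A := Module.compHom A (algebraMap K Λ)
  let _ : Module K B := Module.compHom B (algebraMap K Λ)
  have : IsScalarTower K Λ A := .of_algebraMap_smul fun _ _ ↦ rfl
  have : IsScalarTower K Λ B := .of_algebraMap_smul fun _ _ ↦ rfl
  obtain ⟨l, hl⟩ := (i.restrictScalars K).exists_leftInverse_of_injective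
    (LinearMap.ker_eq_bot.2 hi)
  refine ⟨ofFunctional (toFunctional a ∘ₗ l), LinearMap.ext fun m ↦ LinearMap.ext fun x ↦ ?_⟩
  change eval (a (l (x • i m))) 1 = eval (a m) x
  rw [← map_smul, show l (i (x • m)) = x • m from LinearMap.congr_fun hl _, map_smul, eval_smul,
    one_mul]

theorem exists_embedding [FiniteDimensional K Λ] (M : Type u) [AddCommGroup M] [Module Λ M]
    [Module.Finite Λ M] :
    ∃ (n : ℕ) (c : M →ₗ[Λ] (Fin n → DualRegular K Λ)), Function.Injective c := by
  let _ : Module K M := Module.compHom M (algebraMap K Λ)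
  have : IsScalarTower K Λ M := .of_algebraMap_smul fun _ _ ↦ rfl
  have : Module.Finite K M := .trans Λ M
  let b := Module.finBasis K M
  refine ⟨_, LinearMap.pi fun k ↦ ofFunctional (b.coord k), fun x y hxy ↦ b.ext_elem fun k ↦ ?_⟩
  have : eval (ofFunctional (Λ := Λ) (b.coord k) x) 1 =
    eval (ofFunctional (Λ := Λ) (b.coord k) y) 1 := congrArg (eval · 1) (congrFun hxy k)
  simpa [eval_ofFunctional] using this

end DualRegular

theorem exists_leftApprox_pi (K : Type u) {Λ : Type u} [Field K] [Ring Λ] [Algebra K Λ]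
    [FiniteDimensional K Λ] (M T : Type u) [AddCommGroup M] [Module Λ M] [Module.Finite Λ M]
    [AddCommGroup T] [Module Λ T] [Module.Finite Λ T] :
    ∃ (n : ℕ) (f : M →ₗ[Λ] (Fin n → T)), ∀ g : M →ₗ[Λ] T,
      ∃ h : (Fin n → T) →ₗ[Λ] T, h ∘ₗ f = g := by
  let _ : Module K M := Module.compHom M (algebraMap K Λ)
  have : IsScalarTower K Λ M := .of_algebraMap_smul fun _ _ ↦ rfl
  have : Module.Finite K M := .trans Λ M
  let _ : Module K T := Module.compHom T (algebraMap K Λ)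
  have : IsScalarTower K Λ T := .of_algebraMap_smul fun _ _ ↦ rfl
  have : Module.Finite K T := .trans Λ T
  have : SMulCommClass Λ K T := IsScalarTower.to_smulCommClass'
  have : Module.Finite K (M →ₗ[Λ] T) := .of_injective
    (LinearMap.restrictScalarsₗ K Λ M T K) (LinearMap.restrictScalars_injective K)
  let b := Module.finBasis K (M →ₗ[Λ] T)
  refine ⟨_, LinearMap.pi fun k ↦ b k, fun g ↦ ⟨∑ k, b.repr g k • LinearMap.proj k, ?_⟩⟩
  refine Eq.trans ?_ (b.sum_repr g)
  ext x
  simp [-Module.Basis.sum_repr]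

end Dual

theorem ContravariantlyFinite.exists_isRelInjective (K : Type u) {Λ : Type u} [Field K] [Ring Λ]
    [Algebra K Λ] [FiniteDimensional K Λ] (h : ContravariantlyFinite Λ) :
    ∃ (T : Type u) (_ : AddCommGroup T) (_ : Module Λ T), IsFinProj Λ T ∧ IsRelInjective Λ T ∧
      ∀ (B : Type u) [AddCommGroup B] [Module Λ B], IsFinProj Λ B →
        ∃ (m : ℕ) (c : B →ₗ[Λ] (Fin m → T)), Function.Injective c := by
  have : IsArtinianRing Λ := .of_finite K Λ
  obtain ⟨A, _, _, f₀, hf₀⟩ := h.exists_isFinProjCover (DualRegular K Λ)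
  obtain ⟨T, _, _, f, hf, hmin⟩ := exists_minimal_isFinProjCover hf₀
  refine ⟨T, _, _, hf.isFinProj, hf.isRelInjective hmin DualRegular.exists_extension,
    fun B _ _ hB ↦ ?_⟩
  have := hB.finite
  obtain ⟨m, c, hc⟩ := DualRegular.exists_embedding (K := K) (Λ := Λ) B
  choose l hl using fun k ↦ hf.exists_lift B hB (LinearMap.proj k ∘ₗ c)
  refine ⟨m, LinearMap.pi l, fun x y hxy ↦ hc (funext fun k ↦ ?_)⟩
  have hx := LinearMap.congr_fun (hl k) x
  have hy := LinearMap.congr_fun (hl k) y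
  simp only [LinearMap.comp_apply, LinearMap.proj_apply] at hx hy
  rw [← hx, ← hy]
  exact congrArg f (congrFun hxy k)

end FiniteProjectiveDimension

/-- If `P^∞(Λ-mod)` is contravariantly finite in `Λ-mod`, then it is
covariantly finite in `Λ-mod`: if every finitely generated left `Λ`-module admits a right
`P^∞(Λ-mod)`-approximation, then every finitely generated left `Λ`-module admits a left
`P^∞(Λ-mod)`-approximation. -/
theorem contravariantlyFinite_implies_covariantlyFinite
    (K : Type u) (Λ : Type u) [Field K] [Ring Λ] [Algebra K Λ] [FiniteDimensional K Λ]
    (h : ContravariantlyFinite Λ) : CovariantlyFinite Λ := by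
  intro M hM
  have : IsArtinianRing Λ := .of_finite K Λ
  obtain ⟨d, hd⟩ := h.exists_projDimLE
  obtain ⟨T, _, _, hT, hT', hemb⟩ := h.exists_isRelInjective K
  have := hT.finite
  obtain ⟨A, _, _, f, hA, hf⟩ := exists_leftApprox_hasCoresolution hT
    (fun M _ _ _ ↦ exists_leftApprox_pi K M T) d M hM
  refine ⟨ModuleCat.of Λ A, f, hA.finite,
    hA.projDim.imp fun n hn ↦ (hasProjDimLE_iff Λ n _).2 hn, fun B hB hB' g ↦ ?_⟩
  exact hf B (hasCoresolution_of_liftsLE hT hT' hd hemb d 0 (zero_add d) B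
    ⟨hB, hB'.imp fun n hn ↦ (hasProjDimLE_iff Λ n B).1 hn⟩ (liftsLE_zero B)) g
end

section
/- Let K be a field and Λ a finite-dimensional associative unital K-algebra. If P^∞(Λ-mod) is contravariantly finite in Λ-mod, then every left Λ-module (not necessarily finitely generated) of finite projective dimension is a direct limit of a directed system of finitely generated left Λ-modules of finite projective dimension. -/
universe u

open CategoryTheory

section FiniteProjectiveDimension

variable {Λ : Type u} [Ring Λ]

theorem shortExact_of_exact_s2 {X Y Z : Type u} [AddCommGroup X] [AddCommGroup Y] [AddCommGroup Z]
    [Module Λ X] [Module Λ Y] [Module Λ Z] {f : X →ₗ[Λ] Y} {g : Y →ₗ[Λ] Z}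
    (hf : Function.Injective f) (hfg : Function.Exact f g) (hg : Function.Surjective g) :
    (ShortComplex.mk (ModuleCat.ofHom f) (ModuleCat.ofHom g)
      (by ext x; exact hfg.apply_apply_eq_zero x)).ShortExact :=
  ModuleCat.shortComplex_shortExact _ hfg hf hg

theorem hasProjDimLE_iff_hasProjectiveDimensionLE (n : ℕ) (M : ModuleCat.{u} Λ) :
    HasProjDimLE Λ n M ↔ HasProjectiveDimensionLE M n := by
  induction n generalizing M with
  | zero =>
    rw [← projective_iff_hasProjectiveDimensionLE_zero]
    exact IsProjective.iff_projective M
  | succ n ih =>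
    have key (P : Type u) [AddCommGroup P] [Module Λ P] (g : P →ₗ[Λ] M)
        (hP : Module.Projective Λ P) (hg : Function.Surjective g) :
        HasProjDimLE Λ n (ModuleCat.of Λ (LinearMap.ker g)) ↔
          HasProjectiveDimensionLE M (n + 1) := by
      rw [ih]
      exact ((shortExact_of_exact_s2 (LinearMap.ker g).subtype_injective
        (LinearMap.exact_subtype_ker_map g) hg).hasProjectiveDimensionLT_X₃_iff n
          ((IsProjective.iff_projective P).1 hP)).symm
    constructor
    · rintro ⟨P, g, hP, hg, h⟩
      exact (key P g hP hg).1 h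
    · intro h
      have hg := Finsupp.linearCombination_id_surjective Λ M
      exact ⟨ModuleCat.of Λ (M →₀ Λ), Finsupp.linearCombination Λ id, inferInstance, hg,
        (key _ _ inferInstance hg).2 h⟩

/-- The finitely generated modules of finite projective dimension. -/
structure IsFGFinProjDim (Λ : Type u) [Ring Λ] (M : Type u) [AddCommGroup M] [Module Λ M] :
    Prop where
  finite : Module.Finite Λ M
  hasFinProjDim : HasFinProjDim Λ (ModuleCat.of Λ M)

theorem hasFinProjDim_iff {M : Type u} [AddCommGroup M] [Module Λ M] :
    HasFinProjDim Λ (ModuleCat.of Λ M) ↔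
      ∃ n, HasProjectiveDimensionLT (ModuleCat.of Λ M) n := by
  constructor
  · rintro ⟨n, hn⟩
    exact ⟨n + 1, (hasProjDimLE_iff_hasProjectiveDimensionLE n _).1 hn⟩
  · rintro ⟨n, hn⟩
    exact ⟨n, (hasProjDimLE_iff_hasProjectiveDimensionLE n _).2
      (hasProjectiveDimensionLT_of_ge _ n (n + 1) (Nat.le_succ n))⟩

section Exact

variable {X Y Z : Type u} [AddCommGroup X] [AddCommGroup Y] [AddCommGroup Z]
  [Module Λ X] [Module Λ Y] [Module Λ Z]

theorem HasFinProjDim.of_exact_right {f : X →ₗ[Λ] Y} {g : Y →ₗ[Λ] Z}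
    (hf : Function.Injective f) (hfg : Function.Exact f g) (hg : Function.Surjective g)
    (hX : HasFinProjDim Λ (ModuleCat.of Λ X)) (hY : HasFinProjDim Λ (ModuleCat.of Λ Y)) :
    HasFinProjDim Λ (ModuleCat.of Λ Z) := by
  rw [hasFinProjDim_iff] at hX hY ⊢
  obtain ⟨n, hn⟩ := hX
  obtain ⟨m, hm⟩ := hY
  exact ⟨_, (shortExact_of_exact_s2 hf hfg hg).hasProjectiveDimensionLT_X₃ (n + m)
    (hasProjectiveDimensionLT_of_ge (ModuleCat.of Λ X) n (n + m) (by lia))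
    (hasProjectiveDimensionLT_of_ge (ModuleCat.of Λ Y) m (n + m + 1) (by lia))⟩

theorem HasFinProjDim.of_exact_left {f : X →ₗ[Λ] Y} {g : Y →ₗ[Λ] Z}
    (hf : Function.Injective f) (hfg : Function.Exact f g) (hg : Function.Surjective g)
    (hY : HasFinProjDim Λ (ModuleCat.of Λ Y)) (hZ : HasFinProjDim Λ (ModuleCat.of Λ Z)) :
    HasFinProjDim Λ (ModuleCat.of Λ X) := by
  rw [hasFinProjDim_iff] at hY hZ ⊢
  obtain ⟨n, hn⟩ := hY
  obtain ⟨m, hm⟩ := hZ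
  exact ⟨_, (shortExact_of_exact_s2 hf hfg hg).hasProjectiveDimensionLT_X₁ (n + m)
    (hasProjectiveDimensionLT_of_ge (ModuleCat.of Λ Y) n (n + m) (by lia))
    (hasProjectiveDimensionLT_of_ge (ModuleCat.of Λ Z) m (n + m + 1) (by lia))⟩

theorem HasFinProjDim.of_exact_middle {f : X →ₗ[Λ] Y} {g : Y →ₗ[Λ] Z}
    (hf : Function.Injective f) (hfg : Function.Exact f g) (hg : Function.Surjective g)
    (hX : HasFinProjDim Λ (ModuleCat.of Λ X)) (hZ : HasFinProjDim Λ (ModuleCat.of Λ Z)) :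
    HasFinProjDim Λ (ModuleCat.of Λ Y) := by
  rw [hasFinProjDim_iff] at hX hZ ⊢
  obtain ⟨n, hn⟩ := hX
  obtain ⟨m, hm⟩ := hZ
  exact ⟨_, (shortExact_of_exact_s2 hf hfg hg).hasProjectiveDimensionLT_X₂ (n + m)
    (hasProjectiveDimensionLT_of_ge (ModuleCat.of Λ X) n (n + m) (by lia))
    (hasProjectiveDimensionLT_of_ge (ModuleCat.of Λ Z) m (n + m) (by lia))⟩

theorem HasFinProjDim.of_retract {i : X →ₗ[Λ] Y} {r : Y →ₗ[Λ] X} (h : ∀ x, r (i x) = x)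
    (hY : HasFinProjDim Λ (ModuleCat.of Λ Y)) : HasFinProjDim Λ (ModuleCat.of Λ X) := by
  rw [hasFinProjDim_iff] at hY ⊢
  obtain ⟨n, hn⟩ := hY
  have R : Retract (ModuleCat.of Λ X) (ModuleCat.of Λ Y) :=
    { i := ModuleCat.ofHom i
      r := ModuleCat.ofHom r
      retract := by ext x; exact h x }
  exact ⟨n, R.hasProjectiveDimensionLT n⟩

theorem IsFGFinProjDim.of_projective [Module.Finite Λ X] [hX : Module.Projective Λ X] :
    IsFGFinProjDim Λ X :=
  ⟨inferInstance, 0, hX⟩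

theorem IsFGFinProjDim.prod (hX : IsFGFinProjDim Λ X) (hY : IsFGFinProjDim Λ Y) :
    IsFGFinProjDim Λ (X × Y) :=
  have := hX.finite
  have := hY.finite
  ⟨inferInstance, .of_exact_middle LinearMap.inl_injective (.inl_snd) LinearMap.snd_surjective
    hX.hasFinProjDim hY.hasFinProjDim⟩

theorem IsFGFinProjDim.of_equiv (e : X ≃ₗ[Λ] Y) (hX : IsFGFinProjDim Λ X) : IsFGFinProjDim Λ Y :=
  have := hX.finite
  ⟨.equiv e, .of_retract (i := e.symm.toLinearMap) (r := e.toLinearMap) (by simp) hX.hasFinProjDim⟩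

theorem IsFGFinProjDim.of_exact_right {f : X →ₗ[Λ] Y} {g : Y →ₗ[Λ] Z}
    (hf : Function.Injective f) (hfg : Function.Exact f g) (hg : Function.Surjective g)
    (hX : IsFGFinProjDim Λ X) (hY : IsFGFinProjDim Λ Y) : IsFGFinProjDim Λ Z :=
  have := hY.finite
  ⟨.of_surjective g hg, .of_exact_right hf hfg hg hX.hasFinProjDim hY.hasFinProjDim⟩

theorem IsFGFinProjDim.ker [IsNoetherianRing Λ] {g : Y →ₗ[Λ] Z} (hg : Function.Surjective g)
    (hY : IsFGFinProjDim Λ Y) (hZ : IsFGFinProjDim Λ Z) : IsFGFinProjDim Λ (LinearMap.ker g) :=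
  have := hY.finite
  ⟨inferInstance, .of_exact_left (LinearMap.ker g).subtype_injective
    (LinearMap.exact_subtype_ker_map g) hg hY.hasFinProjDim hZ.hasFinProjDim⟩

theorem IsFGFinProjDim.finsupp {J : Type u} [Finite J] (hX : IsFGFinProjDim Λ X) :
    IsFGFinProjDim Λ (J →₀ X) := by
  induction J using Finite.induction_empty_option with
  | of_equiv e ih => exact .of_equiv (Finsupp.domLCongr e) ih
  | h_empty => exact .of_projective
  | @h_option J _ ih =>
    exact .of_equiv ((Finsupp.linearEquivFunOnFinite Λ X (Option J)).trans
      ((LinearEquiv.piOptionEquivProd Λ).trans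
        ((LinearEquiv.refl Λ X).prodCongr (Finsupp.linearEquivFunOnFinite Λ X J).symm))).symm
      (hX.prod ih)

end Exact

end FiniteProjectiveDimension

section Coinduced

/-- The coinduced module `Hom_K(Λ, C)`, where `Λ` acts by right multiplication on the argument. -/
def CoinducedModule (K Λ C : Type u) [Field K] [Ring Λ] [Algebra K Λ] [AddCommGroup C]
    [Module K C] : Type u :=
  Λ →ₗ[K] C

namespace CoinducedModule

variable {K Λ C : Type u} [Field K] [Ring Λ] [Algebra K Λ] [AddCommGroup C] [Module K C]

instance : AddCommGroup (CoinducedModule K Λ C) :=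
  inferInstanceAs (AddCommGroup (Λ →ₗ[K] C))

instance : Module K (CoinducedModule K Λ C) :=
  inferInstanceAs (Module K (Λ →ₗ[K] C))

instance : FunLike (CoinducedModule K Λ C) Λ C :=
  inferInstanceAs (FunLike (Λ →ₗ[K] C) Λ C)

instance : LinearMapClass (CoinducedModule K Λ C) K Λ C :=
  inferInstanceAs (LinearMapClass (Λ →ₗ[K] C) K Λ C)

@[ext]
theorem ext {f g : CoinducedModule K Λ C} (h : ∀ x, f x = g x) : f = g :=
  DFunLike.ext f g h

instance : SMul Λ (CoinducedModule K Λ C) where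
  smul a f := LinearMap.comp (M₂ := Λ) f (LinearMap.mulRight K a)

@[simp]
theorem smul_apply (a : Λ) (f : CoinducedModule K Λ C) (x : Λ) : (a • f) x = f (x * a) :=
  rfl

@[simp]
theorem add_apply (f g : CoinducedModule K Λ C) (x : Λ) : (f + g) x = f x + g x :=
  rfl

@[simp]
theorem zero_apply (x : Λ) : (0 : CoinducedModule K Λ C) x = 0 :=
  rfl

instance : Module Λ (CoinducedModule K Λ C) where
  one_smul f := by ext; simp
  mul_smul a b f := by ext; simp [mul_assoc]
  smul_zero a := by ext; simp
  smul_add a f g := by ext; simp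
  add_smul a b f := by ext; simp [mul_add]
  zero_smul f := by ext; simp

instance : IsScalarTower K Λ (CoinducedModule K Λ C) where
  smul_assoc k a f := by
    ext x
    change f (x * k • a) = k • f (x * a)
    rw [mul_smul_comm, map_smul]

instance [FiniteDimensional K Λ] [FiniteDimensional K C] :
    Module.Finite Λ (CoinducedModule K Λ C) :=
  have : Module.Finite K (CoinducedModule K Λ C) :=
    inferInstanceAs (Module.Finite K (Λ →ₗ[K] C))
  .of_restrictScalars_finite K Λ _

/-- A `K`-linear map `Y → C` from a `Λ`-module induces a `Λ`-linear map into the coinduced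
module. -/
def lift {Y : Type u} [AddCommGroup Y] [Module K Y] [Module Λ Y] [IsScalarTower K Λ Y]
    (w : Y →ₗ[K] C) : Y →ₗ[Λ] CoinducedModule K Λ C where
  toFun y := w ∘ₗ (LinearMap.toSpanSingleton Λ Y y).restrictScalars K
  map_add' y z := by
    ext x
    change w (x • (y + z)) = w (x • y) + w (x • z)
    simp
  map_smul' a y := by
    ext x
    change w (x • a • y) = w ((x * a) • y)
    rw [mul_smul]

theorem lift_apply {Y : Type u} [AddCommGroup Y] [Module K Y] [Module Λ Y] [IsScalarTower K Λ Y]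
    (w : Y →ₗ[K] C) (y : Y) (x : Λ) : lift w y x = w (x • y) :=
  rfl

instance : Module.Injective Λ (CoinducedModule K Λ C) where
  out X Y _ _ _ _ j hj u := by
    let _ : Module K X := Module.compHom X (algebraMap K Λ)
    let _ : Module K Y := Module.compHom Y (algebraMap K Λ)
    have : IsScalarTower K Λ X := ⟨fun k a x => by
      rw [Algebra.smul_def, mul_smul]; rfl⟩
    have : IsScalarTower K Λ Y := ⟨fun k a x => by
      rw [Algebra.smul_def, mul_smul]; rfl⟩
    let u₁ : X →ₗ[K] C :=
      { toFun x := u x 1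
        map_add' x y := by simp
        map_smul' k x := by
          change u (algebraMap K Λ k • x) 1 = k • u x 1
          rw [map_smul, smul_apply, one_mul, Algebra.algebraMap_eq_smul_one, map_smul] }
    obtain ⟨r, hr⟩ := (j.restrictScalars K).exists_leftInverse_of_injective
      (LinearMap.ker_eq_bot.2 hj)
    refine ⟨lift (u₁ ∘ₗ r), fun x => ext fun a => ?_⟩
    have hrj : r (j (a • x)) = a • x := LinearMap.congr_fun hr (a • x)
    rw [lift_apply, ← map_smul, LinearMap.comp_apply, hrj]
    change u (a • x) 1 = u x a
    simp

end CoinducedModule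

theorem exists_injective_linearMap_finite_injective (K : Type u) {Λ : Type u} [Field K] [Ring Λ]
    [Algebra K Λ] [FiniteDimensional K Λ] (C : Type u) [AddCommGroup C] [Module Λ C]
    [Module.Finite Λ C] :
    ∃ (I : Type u) (_ : AddCommGroup I) (_ : Module Λ I) (i : C →ₗ[Λ] I),
      Module.Finite Λ I ∧ Module.Injective Λ I ∧ Function.Injective i := by
  let _ : Module K C := Module.compHom C (algebraMap K Λ)
  have : IsScalarTower K Λ C := ⟨fun k a x => by
    rw [Algebra.smul_def, mul_smul]; rfl⟩
  have : FiniteDimensional K C := Module.Finite.trans Λ C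
  refine ⟨CoinducedModule K Λ C, inferInstance, inferInstance,
    CoinducedModule.lift LinearMap.id, inferInstance, inferInstance, fun x y hxy => ?_⟩
  simpa [CoinducedModule.lift_apply] using DFunLike.congr_fun hxy (1 : Λ)

end Coinduced

section RelativelyInjective

variable {Λ : Type u} [Ring Λ]

/-- Homomorphisms into `T` extend along monomorphisms between finitely generated modules of finite
projective dimension. -/
def IsFGRelInjective (Λ : Type u) [Ring Λ] (T : Type u) [AddCommGroup T] [Module Λ T] : Prop :=
  ∀ (X Y : Type u) [AddCommGroup X] [AddCommGroup Y] [Module Λ X] [Module Λ Y],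
    IsFGFinProjDim Λ X → IsFGFinProjDim Λ Y → ∀ j : X →ₗ[Λ] Y, Function.Injective j →
      ∀ u : X →ₗ[Λ] T, ∃ v : Y →ₗ[Λ] T, ∀ x, v (j x) = u x

theorem IsFGRelInjective.of_split {T : Type u} [AddCommGroup T] [Module Λ T]
    (hT : IsFGFinProjDim Λ T)
    (h : ∀ (E : Type u) [AddCommGroup E] [Module Λ E], IsFGFinProjDim Λ E →
      ∀ j : T →ₗ[Λ] E, Function.Injective j → ∃ r : E →ₗ[Λ] T, ∀ t, r (j t) = t) :
    IsFGRelInjective Λ T := by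
  intro X Y _ _ _ _ hX hY j hj u
  let a : X →ₗ[Λ] T × Y := u.prod (-j)
  have ha : Function.Injective a := fun x y hxy => hj (neg_injective (congrArg Prod.snd hxy))
  let q := (LinearMap.range a).mkQ
  have hE := hX.of_exact_right ha (LinearMap.exact_map_mkQ_range a) (Submodule.mkQ_surjective _)
    (hT.prod hY)
  obtain ⟨r, hr⟩ := h _ hE (q ∘ₗ LinearMap.inl Λ T Y) <| by
    rw [injective_iff_map_eq_zero]
    intro t ht
    obtain ⟨x, hx⟩ := (Submodule.Quotient.mk_eq_zero _).1 ht
    have h1 : u x = t := congrArg Prod.fst hx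
    have h2 : -j x = 0 := congrArg Prod.snd hx
    rw [neg_eq_zero, map_eq_zero_iff j hj] at h2
    rw [← h1, h2, map_zero]
  refine ⟨r ∘ₗ q ∘ₗ LinearMap.inr Λ T Y, fun x => ?_⟩
  rw [← hr (u x)]
  refine congrArg r ((Submodule.Quotient.eq _).2 ⟨-x, ?_⟩)
  ext <;> simp [a]

theorem IsRightApprox.exists_minimal [IsArtinianRing Λ] (I : Type u) [AddCommGroup I]
    [Module Λ I] (h : ∃ (A : ModuleCat.{u} Λ) (f : A →ₗ[Λ] I), IsRightApprox Λ (.of Λ I) A f) :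
    ∃ (A : ModuleCat.{u} Λ) (f : A →ₗ[Λ] I), IsRightApprox Λ (.of Λ I) A f ∧
      ∀ φ : A →ₗ[Λ] A, f ∘ₗ φ = f → Function.Bijective φ := by
  obtain ⟨ℓ, ⟨A, f, hf, rfl⟩, hmin⟩ := wellFounded_lt.has_min
    {ℓ : ℕ∞ | ∃ (A : ModuleCat.{u} Λ) (f : A →ₗ[Λ] I), IsRightApprox Λ (.of Λ I) A f ∧
      Module.length Λ A = ℓ} (by obtain ⟨A, f, hf⟩ := h; exact ⟨_, A, f, hf, rfl⟩)
  refine ⟨A, f, hf, fun φ hφ => ?_⟩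
  have := hf.1
  suffices Function.Surjective φ from
    ⟨IsNoetherian.injective_of_surjective_endomorphism φ this, this⟩
  obtain ⟨n, hc, hn⟩ := (φ.eventually_isCompl_ker_pow_range_pow.and
    (Filter.eventually_ge_atTop 1)).exists
  have hpow : ∀ m, f ∘ₗ (φ ^ m) = f := fun m => by
    induction m with
    | zero => rfl
    | succ m ih => rw [pow_succ', Module.End.mul_eq_comp, ← LinearMap.comp_assoc, hφ, ih]
  have hR : IsRightApprox Λ (.of Λ I) (.of Λ (LinearMap.range (φ ^ n)))
      (f ∘ₗ (LinearMap.range (φ ^ n)).subtype) := by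
    refine ⟨inferInstanceAs (Module.Finite Λ (LinearMap.range (φ ^ n))),
      .of_retract (i := (LinearMap.range (φ ^ n)).subtype)
        (r := Submodule.projectionOnto _ _ hc.symm)
        (fun x => Submodule.projectionOnto_apply_left _ x) hf.2.1, fun B hB hB' g => ?_⟩
    obtain ⟨k, hk⟩ := hf.2.2 B hB hB' g
    refine ⟨(φ ^ n).rangeRestrict ∘ₗ k, ?_⟩
    rw [← hk, LinearMap.comp_assoc, ← LinearMap.comp_assoc _ _ (Submodule.subtype _)]
    exact congrArg (· ∘ₗ k) (hpow n)
  have htop : LinearMap.range (φ ^ n) = ⊤ := by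
    by_contra hne
    exact hmin _ ⟨_, _, hR, rfl⟩ (Submodule.length_lt hne)
  rw [← LinearMap.range_eq_top, eq_top_iff, ← htop]
  obtain ⟨m, rfl⟩ := Nat.exists_eq_add_of_le hn
  rw [pow_add, pow_one]
  exact LinearMap.range_comp_le_range _ _

theorem ContravariantlyFinite.exists_embedding (K : Type u) [Field K] [Algebra K Λ]
    [FiniteDimensional K Λ] (h : ContravariantlyFinite Λ) (C : Type u) [AddCommGroup C]
    [Module Λ C] (hC : IsFGFinProjDim Λ C) :
    ∃ (T : Type u) (_ : AddCommGroup T) (_ : Module Λ T) (i : C →ₗ[Λ] T),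
      IsFGFinProjDim Λ T ∧ IsFGRelInjective Λ T ∧ Function.Injective i := by
  have := hC.finite
  have : IsArtinianRing Λ := .of_finite K Λ
  obtain ⟨I, _, _, i, hI, hinj, hi⟩ := exists_injective_linearMap_finite_injective K C (Λ := Λ)
  obtain ⟨A, f, hf, hmin⟩ := IsRightApprox.exists_minimal I (h (.of Λ I) hI)
  obtain ⟨k, hk⟩ := hf.2.2 (.of Λ C) hC.finite hC.hasFinProjDim i
  have hA : IsFGFinProjDim Λ A := ⟨hf.1, hf.2.1⟩
  refine ⟨A, inferInstance, inferInstance, k, hA, .of_split hA ?_, ?_⟩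
  · intro E _ _ hE j hj
    obtain ⟨g, hg⟩ := hinj.out j hj f
    obtain ⟨p, hp⟩ := hf.2.2 (.of Λ E) hE.finite hE.hasFinProjDim g
    have hb := hmin (p ∘ₗ j) (by
      ext x
      exact (LinearMap.congr_fun hp (j x)).trans (hg x))
    refine ⟨(LinearEquiv.ofBijective _ hb).symm.toLinearMap ∘ₗ p, fun t => ?_⟩
    exact (LinearEquiv.ofBijective _ hb).symm_apply_apply t
  · refine Function.Injective.of_comp (f := f) ?_
    rwa [← LinearMap.coe_comp, hk]

end RelativelyInjective

section Factorization

variable {Λ : Type u} [Ring Λ]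

theorem LinearMap.exists_comp_eq_of_ker_le {X Y Z : Type*} [AddCommGroup X] [AddCommGroup Y]
    [AddCommGroup Z] [Module Λ X] [Module Λ Y] [Module Λ Z] (p : X →ₗ[Λ] Y)
    (hp : Function.Surjective p) (g : X →ₗ[Λ] Z) (h : ∀ x, p x = 0 → g x = 0) :
    ∃ f : Y →ₗ[Λ] Z, ∀ x, f (p x) = g x := by
  refine ⟨(LinearMap.ker p).liftQ g h ∘ₗ (p.quotKerEquivOfSurjective hp).symm.toLinearMap,
    fun x => ?_⟩
  have : (p.quotKerEquivOfSurjective hp).symm (p x) = Submodule.Quotient.mk x := by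
    rw [LinearEquiv.symm_apply_eq]
    rfl
  simp only [LinearMap.comp_apply, LinearEquiv.coe_coe, this]
  rfl

theorem LinearMap.exists_factor_of_exact {W X Y Z : Type*} [AddCommGroup W] [AddCommGroup X]
    [AddCommGroup Y] [AddCommGroup Z] [Module Λ W] [Module Λ X] [Module Λ Y] [Module Λ Z]
    {f : X →ₗ[Λ] Y} {g : Y →ₗ[Λ] Z} (hf : Function.Injective f) (hfg : Function.Exact f g)
    (k : W →ₗ[Λ] Y) (hk : ∀ w, g (k w) = 0) : ∃ l : W →ₗ[Λ] X, ∀ w, f (l w) = k w := by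
  refine ⟨(LinearEquiv.ofInjective f hf).symm.toLinearMap ∘ₗ
    k.codRestrict (LinearMap.range f) (fun w => (hfg _).1 (hk w)), fun w => ?_⟩
  exact congrArg Subtype.val ((LinearEquiv.ofInjective f hf).apply_symm_apply _)

theorem Finsupp.lmapDomain_lsubtypeDomain {J C : Type*} [AddCommGroup C] [Module Λ C] {s : Set J}
    {x : J →₀ C} (hx : x ∈ Finsupp.supported C Λ s) :
    Finsupp.lmapDomain C Λ Subtype.val (Finsupp.lsubtypeDomain (R := Λ) s x) = x := by
  ext j
  by_cases hj : j ∈ s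
  · exact Finsupp.mapDomain_apply Subtype.val_injective _ (⟨j, hj⟩ : s)
  · rw [Finsupp.notMem_support_iff.1 fun h => hj (hx h)]
    exact Finsupp.mapDomain_of_notMem_range _ _ (by simpa using hj)

/-- Every homomorphism from a finitely generated module to `M` factors through a finitely
generated module of finite projective dimension. -/
def FactorsThroughFG (Λ : Type u) [Ring Λ] (M : Type u) [AddCommGroup M] [Module Λ M] : Prop :=
  ∀ (X : Type u) [AddCommGroup X] [Module Λ X], Module.Finite Λ X → ∀ g : X →ₗ[Λ] M,
    ∃ (C : Type u) (_ : AddCommGroup C) (_ : Module Λ C) (a : X →ₗ[Λ] C) (b : C →ₗ[Λ] M),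
      IsFGFinProjDim Λ C ∧ ∀ x, b (a x) = g x

namespace FactorsThroughFG

variable {M N W : Type u} [AddCommGroup M] [AddCommGroup N] [AddCommGroup W]
  [Module Λ M] [Module Λ N] [Module Λ W]

theorem of_retract {i : M →ₗ[Λ] N} {r : N →ₗ[Λ] M} (h : ∀ x, r (i x) = x)
    (hN : FactorsThroughFG Λ N) : FactorsThroughFG Λ M := by
  intro X _ _ hX g
  obtain ⟨C, _, _, a, b, hC, hab⟩ := hN X hX (i ∘ₗ g)
  exact ⟨C, _, _, a, r ∘ₗ b, hC, fun x => by simp [hab, h]⟩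

theorem finsupp {C : Type u} [AddCommGroup C] [Module Λ C] (hC : IsFGFinProjDim Λ C)
    (J : Type u) : FactorsThroughFG Λ (J →₀ C) := by
  classical
  intro X _ _ hX g
  obtain ⟨s, hs⟩ := hX.fg_top
  let J₀ : Finset J := s.biUnion fun x => (g x).support
  have hJ : ∀ x, g x ∈ Finsupp.supported C Λ (J₀ : Set J) := by
    have : (⊤ : Submodule Λ X) ≤ (Finsupp.supported C Λ (J₀ : Set J)).comap g := by
      rw [← hs, Submodule.span_le]
      intro x hx
      exact Finset.coe_subset.2 (Finset.subset_biUnion_of_mem (fun x => (g x).support) hx)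
    exact fun x => this trivial
  refine ⟨(J₀ : Set J) →₀ C, inferInstance, inferInstance,
    Finsupp.lsubtypeDomain (J₀ : Set J) ∘ₗ g, Finsupp.lmapDomain C Λ Subtype.val, hC.finsupp,
    fun x => Finsupp.lmapDomain_lsubtypeDomain (hJ x)⟩

theorem of_exact [IsNoetherianRing Λ] {i : M →ₗ[Λ] W} {p : W →ₗ[Λ] N}
    (hi : Function.Injective i) (hip : Function.Exact i p) (hp : Function.Surjective p)
    (hM : FactorsThroughFG Λ M) (hN : FactorsThroughFG Λ N) : FactorsThroughFG Λ W := by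
  intro X _ _ hX g
  obtain ⟨C, _, _, a, b, hC, hab⟩ := hN X hX (p ∘ₗ g)
  have := hC.finite
  obtain ⟨n, q, hq⟩ := Module.Finite.exists_fin' Λ C
  obtain ⟨s, hs⟩ := Module.projective_lifting_property p (b ∘ₗ q) hp
  have hs (y) : p (s y) = b (q y) := LinearMap.congr_fun hs y
  let D : Submodule Λ (X × (Fin n → Λ)) :=
    LinearMap.ker (a ∘ₗ LinearMap.fst Λ X (Fin n → Λ) - q ∘ₗ LinearMap.snd Λ X (Fin n → Λ))
  have hD (d : D) : a d.1.1 = q d.1.2 := sub_eq_zero.1 d.2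
  obtain ⟨d, hd⟩ := LinearMap.exists_factor_of_exact hi hip
    ((g ∘ₗ LinearMap.fst Λ X (Fin n → Λ) - s ∘ₗ LinearMap.snd Λ X (Fin n → Λ)) ∘ₗ D.subtype)
    (fun x => by simp [hs, ← hD, hab])
  have hd (x : D) : i (d x) = g x.1.1 - s x.1.2 := hd x
  obtain ⟨C', _, _, a', b', hC', hab'⟩ := hM D inferInstance d
  let ω : LinearMap.ker q →ₗ[Λ] D :=
    (LinearMap.inr Λ X (Fin n → Λ) ∘ₗ (LinearMap.ker q).subtype).codRestrict D
      (fun y => by simp [D])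
  let k : LinearMap.ker q →ₗ[Λ] C' × (Fin n → Λ) := (a' ∘ₗ ω).prod (LinearMap.ker q).subtype
  have hk : Function.Injective k := fun x y hxy => Subtype.ext (congrArg Prod.snd hxy)
  let π := (LinearMap.range k).mkQ
  have hE := (IsFGFinProjDim.ker hq .of_projective hC).of_exact_right hk
    (LinearMap.exact_map_mkQ_range k) (Submodule.mkQ_surjective _)
    (hC'.prod .of_projective)
  obtain ⟨f, hf⟩ := LinearMap.exists_comp_eq_of_ker_le (LinearMap.fst Λ X (Fin n → Λ) ∘ₗ D.subtype)
    (fun x => by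
      obtain ⟨y, hy⟩ := hq (a x)
      exact ⟨⟨(x, y), by simp [D, hy]⟩, rfl⟩)
    (π ∘ₗ a'.prod (LinearMap.snd Λ X (Fin n → Λ) ∘ₗ D.subtype))
    (fun x hx => (Submodule.Quotient.mk_eq_zero _).2 <| by
      have hx : x.1.1 = 0 := hx
      have hy : x.1.2 ∈ LinearMap.ker q := by
        rw [LinearMap.mem_ker, ← hD, hx, map_zero]
      refine ⟨⟨x.1.2, hy⟩, Prod.ext (congrArg a' ?_) rfl⟩
      exact Subtype.ext (Prod.ext hx.symm rfl))
  refine ⟨_, _, _, f, (LinearMap.range k).liftQ ((i ∘ₗ b').coprod s) ?_, hE, fun x => ?_⟩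
  · rintro _ ⟨y, rfl⟩
    change i (b' (a' (ω y))) + s y = 0
    rw [hab', hd]
    change g 0 - s y.1 + s y.1 = 0
    simp
  · obtain ⟨y, hy⟩ := hq (a x)
    have := hf ⟨(x, y), by simp [D, hy]⟩
    have hx : f x = π (a' ⟨(x, y), by simp [D, hy]⟩, y) := this
    rw [hx]
    simp [π, hab', hd]

end FactorsThroughFG

end Factorization

section LinearCompactness

/-- A system of linear equations for a functional is solvable as soon as every finite subsystem
is. -/
theorem exists_dual_eq_of_forall_finset {K E S : Type*} [Field K] [AddCommGroup E] [Module K E]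
    (e : S → E) (c : S → K)
    (h : ∀ t : Finset S, ∃ θ : Module.Dual K E, ∀ s ∈ t, θ (e s) = c s) :
    ∃ θ : Module.Dual K E, ∀ s, θ (e s) = c s := by
  let p := Finsupp.linearCombination K e
  let γ := Finsupp.linearCombination K c
  obtain ⟨f, hf⟩ := LinearMap.exists_comp_eq_of_ker_le p.rangeRestrict
    p.surjective_rangeRestrict γ fun x hx => by
      obtain ⟨θ, hθ⟩ := h x.support
      have hx : p x = 0 := congrArg Subtype.val hx
      have : θ (p x) = γ x := by
        simp only [p, γ, Finsupp.linearCombination_apply, Finsupp.sum, map_sum, map_smul]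
        exact Finset.sum_congr rfl fun s hs => by rw [hθ s hs]
      rw [← this, hx, map_zero]
  obtain ⟨θ, hθ⟩ := f.exists_extend
  refine ⟨θ, fun s => ?_⟩
  have hs : p (Finsupp.single s 1) = e s := by simp [p]
  have h1 := hf (Finsupp.single s 1)
  rw [← hθ] at h1
  have h2 : θ (p (Finsupp.single s 1)) = γ (Finsupp.single s 1) := h1
  simpa [hs, γ] using h2

theorem Module.Dual.ext_of_forall (K : Type*) {T : Type*} [Field K] [AddCommGroup T] [Module K T]
    {x y : T} (h : ∀ ξ : Module.Dual K T, ξ x = ξ y) : x = y :=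
  sub_eq_zero.1 <| (Module.forall_dual_apply_eq_zero_iff K _).1 fun ξ => by
    rw [map_sub, h, sub_self]

open scoped TensorProduct in
/-- A finite-dimensional module is linearly compact: a homomorphism into it extends along `i` as
soon as it does so up to any finite set of conditions. -/
theorem LinearMap.exists_extension_of_finite {K Λ Q L T : Type*} [Field K] [Ring Λ] [Algebra K Λ]
    [AddCommGroup Q] [AddCommGroup L] [AddCommGroup T] [Module Λ Q] [Module Λ L] [Module Λ T]
    [Module K L] [IsScalarTower K Λ L] [Module K T] [IsScalarTower K Λ T] [FiniteDimensional K T]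
    (i : Q →ₗ[Λ] L) (u : Q →ₗ[Λ] T)
    (h : ∀ (s : Finset L) (t : Finset Q), ∃ g : L →ₗ[K] T,
      (∀ l ∈ s, ∀ a : Λ, g (a • l) = a • g l) ∧ ∀ q ∈ t, g (i q) = u q) :
    ∃ v : L →ₗ[Λ] T, ∀ q, v (i q) = u q := by
  classical
  let actT (a : Λ) : T →ₗ[K] T := Module.toModuleEnd K T a
  let e : (Module.Dual K T × Λ × L) ⊕ (Module.Dual K T × Q) → Module.Dual K T ⊗[K] L :=
    Sum.elim (fun x => x.1 ⊗ₜ (x.2.1 • x.2.2) - (x.1 ∘ₗ actT x.2.1) ⊗ₜ x.2.2)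
      (fun x => x.1 ⊗ₜ i x.2)
  let c : (Module.Dual K T × Λ × L) ⊕ (Module.Dual K T × Q) → K :=
    Sum.elim (fun _ => 0) (fun x => x.1 (u x.2))
  obtain ⟨θ, hθ⟩ := exists_dual_eq_of_forall_finset e c fun t => by
    obtain ⟨g, hg, hg'⟩ := h (t.toLeft.image fun x => x.2.2) (t.toRight.image fun x => x.2)
    refine ⟨TensorProduct.lift ((LinearMap.id (R := K) (M := Module.Dual K T)).compl₂ g), ?_⟩
    rintro (x | x) hx
    · have := hg x.2.2 (Finset.mem_image_of_mem _ (Finset.mem_toLeft.2 hx)) x.2.1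
      simp [e, c, this, actT]
    · have := hg' x.2 (Finset.mem_image_of_mem (fun x => x.2) (Finset.mem_toRight.2 hx))
      simp [e, c, this]
  let g : L →ₗ[K] T := (Module.evalEquiv K T).symm.toLinearMap ∘ₗ (TensorProduct.curry θ).flip
  have hg (ξ : Module.Dual K T) (l : L) : ξ (g l) = θ (ξ ⊗ₜ l) := by
    simp [g]
  refine ⟨{ g with map_smul' := fun a l => ?_ }, fun q => ?_⟩
  · refine Module.Dual.ext_of_forall K fun ξ => ?_
    have h0 : θ (ξ ⊗ₜ (a • l) - (ξ ∘ₗ actT a) ⊗ₜ l) = 0 := hθ (.inl (ξ, a, l))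
    rw [map_sub, sub_eq_zero, ← hg, ← hg] at h0
    exact h0
  · refine Module.Dual.ext_of_forall K fun ξ => ?_
    exact (hg ξ _).trans (hθ (.inr (ξ, q)))

/-- For a finite-dimensional module `T`, the direct sum of copies of `T` is a direct summand of the
direct product. -/
theorem exists_linearMap_finsupp_leftInverse (K : Type*) {Λ T : Type*} [Field K] [Ring Λ]
    [Algebra K Λ] [AddCommGroup T] [Module Λ T] [Module K T] [IsScalarTower K Λ T]
    [FiniteDimensional K T] (J : Type*) :
    ∃ r : (J → T) →ₗ[Λ] (J →₀ T), ∀ x : J →₀ T, r x = x := by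
  obtain ⟨ρ, hρ⟩ := (Finsupp.lcoeFun (R := K) (M := K) (α := J)).exists_leftInverse_of_injective
    (LinearMap.ker_eq_bot.2 DFunLike.coe_injective)
  have hρ (x : J →₀ K) : ρ x = x := LinearMap.congr_fun hρ x
  let b := Module.finBasis K T
  let R : (J → T) → (J →₀ T) := fun f =>
    ∑ n, (ρ fun j => b.coord n (f j)).mapRange (· • b n) (zero_smul _ _)
  have hR (ξ : Module.Dual K T) (f : J → T) (j : J) : ξ (R f j) = ρ (fun j => ξ (f j)) j := by
    have h1 : (fun j => ξ (f j)) = ∑ n, ξ (b n) • fun j => b.coord n (f j) := by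
      ext j
      have := congrArg ξ (b.sum_repr (f j))
      rw [map_sum] at this
      rw [← this]
      simp [mul_comm]
    rw [h1]
    simp [R, Finsupp.finsetSum_apply, mul_comm]
  have ext_iff {f g : J →₀ T} (h : ∀ (ξ : Module.Dual K T) j, ξ (f j) = ξ (g j)) : f = g :=
    Finsupp.ext fun j => Module.Dual.ext_of_forall K fun ξ => h ξ j
  refine ⟨⟨⟨R, fun f g => ext_iff fun ξ j => ?_⟩, fun a f => ext_iff fun ξ j => ?_⟩,
    fun x => ext_iff fun ξ j => ?_⟩
  · rw [Finsupp.add_apply, map_add, hR, hR, hR]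
    simp only [Pi.add_apply, map_add]
    exact DFunLike.congr_fun (map_add ρ (fun j => ξ (f j)) (fun j => ξ (g j))) j
  · have h1 := hR (ξ ∘ₗ Module.toModuleEnd K T a) f j
    rw [hR]
    exact h1.symm
  · refine (hR ξ x j).trans ?_
    exact DFunLike.congr_fun (hρ (x.mapRange ξ (map_zero ξ))) j

end LinearCompactness

section SplitInjective

/-- A module that is injective relative to the modules satisfying `FactorsThroughFG`. -/
structure IsFactorsRelInjective (Λ : Type u) [Ring Λ] (Q : Type u) [AddCommGroup Q] [Module Λ Q] :
    Prop where
  factorsThroughFG : FactorsThroughFG Λ Q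
  exists_retraction (L : Type u) [AddCommGroup L] [Module Λ L] (hL : FactorsThroughFG Λ L)
    (i : Q →ₗ[Λ] L) (hi : Function.Injective i) : ∃ r : L →ₗ[Λ] Q, ∀ q, r (i q) = q

variable {Λ : Type u} [Ring Λ]

theorem IsFGRelInjective.exists_extension (K : Type u) [Field K] [Algebra K Λ]
    [FiniteDimensional K Λ] {T L J : Type u} [AddCommGroup T] [Module Λ T] [AddCommGroup L]
    [Module Λ L] (hT : IsFGFinProjDim Λ T) (hT' : IsFGRelInjective Λ T)
    (hL : FactorsThroughFG Λ L) (i : (J →₀ T) →ₗ[Λ] L) (hi : Function.Injective i)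
    (u : (J →₀ T) →ₗ[Λ] T) : ∃ v : L →ₗ[Λ] T, ∀ q, v (i q) = u q := by
  classical
  have := hT.finite
  let _ : Module K L := Module.compHom L (algebraMap K Λ)
  have : IsScalarTower K Λ L := ⟨fun k a x => by rw [Algebra.smul_def, mul_smul]; rfl⟩
  let _ : Module K T := Module.compHom T (algebraMap K Λ)
  have : IsScalarTower K Λ T := ⟨fun k a x => by rw [Algebra.smul_def, mul_smul]; rfl⟩
  have : FiniteDimensional K T := Module.Finite.trans Λ T
  refine LinearMap.exists_extension_of_finite (K := K) i u fun s t => ?_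
  let J₀ : Finset J := t.biUnion fun q => q.support
  let ε : ((J₀ : Set J) →₀ T) →ₗ[Λ] (J →₀ T) := Finsupp.lmapDomain T Λ Subtype.val
  have hε : Function.Injective ε := Finsupp.mapDomain_injective Subtype.val_injective
  have ht : ∀ q ∈ t, ∃ x, ε x = q := fun q hq =>
    ⟨_, Finsupp.lmapDomain_lsubtypeDomain
      (Finset.coe_subset.2 (Finset.subset_biUnion_of_mem (fun q => q.support) hq))⟩
  let Z : Submodule Λ L := Submodule.span Λ s ⊔ LinearMap.range (i ∘ₗ ε)
  have := (hT.finsupp (J := (J₀ : Set J))).finite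
  have hZ : Module.Finite Λ Z := Module.Finite.iff_fg.2
    ((Submodule.fg_span s.finite_toSet).sup (Module.Finite.iff_fg.1 inferInstance))
  obtain ⟨C, _, _, a, b, hC, hab⟩ := hL Z hZ Z.subtype
  let κ : ((J₀ : Set J) →₀ T) →ₗ[Λ] Z :=
    (i ∘ₗ ε).codRestrict Z fun x => Submodule.mem_sup_right ⟨x, rfl⟩
  have hκ : Function.Injective (a ∘ₗ κ) := by
    refine Function.Injective.of_comp (f := b) ?_
    have : b ∘ (a ∘ₗ κ) = i ∘ ε := funext fun x => hab (κ x)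
    rw [this]
    exact hi.comp hε
  obtain ⟨v, hv⟩ := hT' _ _ hT.finsupp hC (a ∘ₗ κ) hκ (u ∘ₗ ε)
  obtain ⟨g, hg⟩ := ((v ∘ₗ a).restrictScalars K).exists_extend (p := Z.restrictScalars K)
  have hg (z : Z) : g z = v (a z) := LinearMap.congr_fun hg z
  refine ⟨g, fun l hl c => ?_, fun q hq => ?_⟩
  · have hl : l ∈ Z := Submodule.mem_sup_left (Submodule.subset_span hl)
    rw [hg ⟨l, hl⟩, ← map_smul, ← map_smul]
    exact hg (c • ⟨l, hl⟩)
  · obtain ⟨x, rfl⟩ := ht q hq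
    exact (hg (κ x)).trans (hv x)

theorem IsFGRelInjective.isFactorsRelInjective_finsupp (K : Type u) [Field K] [Algebra K Λ]
    [FiniteDimensional K Λ] {T : Type u} [AddCommGroup T] [Module Λ T]
    (hT : IsFGFinProjDim Λ T) (hT' : IsFGRelInjective Λ T) (J : Type u) :
    IsFactorsRelInjective Λ (J →₀ T) := by
  refine ⟨.finsupp hT J, fun L _ _ hL i hi => ?_⟩
  have := hT.finite
  let _ : Module K T := Module.compHom T (algebraMap K Λ)
  have : IsScalarTower K Λ T := ⟨fun k a x => by rw [Algebra.smul_def, mul_smul]; rfl⟩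
  have : FiniteDimensional K T := Module.Finite.trans Λ T
  obtain ⟨r, hr⟩ := exists_linearMap_finsupp_leftInverse K (Λ := Λ) (T := T) J
  choose v hv using fun j => hT'.exists_extension K hT hL i hi (Finsupp.lapply j)
  refine ⟨r ∘ₗ LinearMap.pi v, fun q => ?_⟩
  rw [LinearMap.comp_apply, ← hr q]
  exact congrArg r (funext fun j => (hv j _).trans (by rw [hr]; rfl))

end SplitInjective

section Pushout

variable {Λ : Type u} [Ring Λ]

/-- The pushout of a short exact sequence `X → Y → Z` along `u : X → X'`. -/
theorem LinearMap.exists_pushout_of_exact {X Y Z X' : Type u} [AddCommGroup X] [AddCommGroup Y]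
    [AddCommGroup Z] [AddCommGroup X'] [Module Λ X] [Module Λ Y] [Module Λ Z] [Module Λ X']
    {i : X →ₗ[Λ] Y} {p : Y →ₗ[Λ] Z} (hi : Function.Injective i) (hip : Function.Exact i p)
    (hp : Function.Surjective p) (u : X →ₗ[Λ] X') :
    ∃ (E : Type u) (_ : AddCommGroup E) (_ : Module Λ E) (a : X' →ₗ[Λ] E) (b : Y →ₗ[Λ] E)
      (c : E →ₗ[Λ] Z), Function.Injective a ∧ Function.Exact a c ∧ Function.Surjective c ∧
      (∀ x, a (u x) = b (i x)) ∧ (Function.Injective u → Function.Injective b) ∧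
      ∀ (Z' : Type u) [AddCommGroup Z'] [Module Λ Z'] (v : X' →ₗ[Λ] Z'), Function.Exact u v →
        Function.Surjective v → ∃ d : E →ₗ[Λ] Z', Function.Exact b d ∧ Function.Surjective d := by
  let R := LinearMap.range (u.prod (-i))
  let a : X' →ₗ[Λ] (X' × Y) ⧸ R := R.mkQ ∘ₗ LinearMap.inl Λ X' Y
  let b : Y →ₗ[Λ] (X' × Y) ⧸ R := R.mkQ ∘ₗ LinearMap.inr Λ X' Y
  have hab (x) : a (u x) = b (i x) := (Submodule.Quotient.eq R).2 ⟨x, by simp⟩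
  have hab' (x y) (h : a x = b y) : ∃ z, u z = x ∧ i z = y := by
    obtain ⟨z, hz⟩ := (Submodule.Quotient.eq R).1 h
    exact ⟨z, by simpa using congrArg Prod.fst hz, by simpa using congrArg Prod.snd hz⟩
  have hE (e) : ∃ x y, e = a x + b y := by
    obtain ⟨⟨x, y⟩, rfl⟩ := R.mkQ_surjective e
    exact ⟨x, y, congrArg R.mkQ (by simp : (x, y) = (x, 0) + (0, y))⟩
  have desc (V : Type u) [AddCommGroup V] [Module Λ V] (f : X' →ₗ[Λ] V) (g : Y →ₗ[Λ] V)
      (h : ∀ x, f (u x) = g (i x)) :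
      ∃ k : ((X' × Y) ⧸ R) →ₗ[Λ] V, (∀ x, k (a x) = f x) ∧ ∀ y, k (b y) = g y := by
    refine ⟨R.liftQ (f.coprod g) ?_, fun x => ?_, fun y => ?_⟩
    · rintro _ ⟨x, rfl⟩
      simp [h]
    · simp [a]
    · simp [b]
  obtain ⟨c, hca, hcb⟩ := desc Z 0 p fun x => (hip.apply_apply_eq_zero x).symm
  refine ⟨_, _, _, a, b, c, ?_, ?_, ?_, hab, ?_, ?_⟩
  · refine (injective_iff_map_eq_zero a).2 fun x hx => ?_
    obtain ⟨z, rfl, hz⟩ := hab' x 0 (by rw [hx, map_zero])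
    rw [hi (hz.trans (map_zero i).symm), map_zero]
  · intro e
    constructor
    · intro he
      obtain ⟨x, y, rfl⟩ := hE e
      rw [map_add, hca, hcb, LinearMap.zero_apply, zero_add] at he
      obtain ⟨z, rfl⟩ := (hip y).1 he
      exact ⟨x + u z, by rw [map_add, hab]⟩
    · rintro ⟨x, rfl⟩
      rw [hca, LinearMap.zero_apply]
  · intro z
    obtain ⟨y, rfl⟩ := hp z
    exact ⟨b y, hcb y⟩
  · intro hu
    refine (injective_iff_map_eq_zero b).2 fun y hy => ?_
    obtain ⟨z, hz, rfl⟩ := hab' 0 y (by rw [hy, map_zero])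
    rw [hu (hz.trans (map_zero u).symm), map_zero]
  · intro Z' _ _ v huv hv
    obtain ⟨d, hda, hdb⟩ := desc Z' v 0 fun x => huv.apply_apply_eq_zero x
    refine ⟨d, fun e => ⟨fun he => ?_, ?_⟩, fun z => ?_⟩
    · obtain ⟨x, y, rfl⟩ := hE e
      rw [map_add, hda, hdb, LinearMap.zero_apply, add_zero] at he
      obtain ⟨z, rfl⟩ := (huv x).1 he
      exact ⟨i z + y, by rw [map_add, hab]⟩
    · rintro ⟨y, rfl⟩
      rw [hdb, LinearMap.zero_apply]
    · obtain ⟨x, rfl⟩ := hv z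
      exact ⟨a x, hda x⟩

end Pushout

section RelInjective

variable {Λ : Type u} [Ring Λ] {Q R : Type u} [AddCommGroup Q]
  [AddCommGroup R] [Module Λ Q] [Module Λ R]

theorem FactorsThroughFG.of_projective (P : Type u) [AddCommGroup P] [Module Λ P]
    [hP : Module.Projective Λ P] : FactorsThroughFG Λ P := by
  obtain ⟨s, hs⟩ := Module.projective_def'.1 hP
  exact .of_retract (i := s) (r := Finsupp.linearCombination Λ id) (LinearMap.congr_fun hs)
    (.finsupp .of_projective P)

theorem FactorsThroughFG.ker_retraction {i : R →ₗ[Λ] Q} {r : Q →ₗ[Λ] R} (h : ∀ x, r (i x) = x)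
    (hQ : FactorsThroughFG Λ Q) : FactorsThroughFG Λ (LinearMap.ker r) :=
  .of_retract (i := (LinearMap.ker r).subtype)
    (r := (LinearMap.id - i ∘ₗ r).codRestrict (LinearMap.ker r) fun x => by simp [h])
    (fun x => Subtype.ext (by simp [LinearMap.mem_ker.1 x.2])) hQ

variable [IsNoetherianRing Λ]

theorem FactorsThroughFG.prod (hQ : FactorsThroughFG Λ Q) (hR : FactorsThroughFG Λ R) :
    FactorsThroughFG Λ (Q × R) :=
  .of_exact LinearMap.inl_injective .inl_snd LinearMap.snd_surjective hQ hR

namespace IsFactorsRelInjective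

theorem of_retract {i : R →ₗ[Λ] Q} {r : Q →ₗ[Λ] R} (h : ∀ x, r (i x) = x)
    (hQ : IsFactorsRelInjective Λ Q) : IsFactorsRelInjective Λ R := by
  refine ⟨.of_retract h hQ.factorsThroughFG, fun L _ _ hL j hj => ?_⟩
  let pr : Q →ₗ[Λ] LinearMap.ker r :=
    (LinearMap.id - i ∘ₗ r).codRestrict (LinearMap.ker r) fun x => by simp [h]
  have hpr (x) : (pr x : Q) = x - i (r x) := rfl
  obtain ⟨ρ, hρ⟩ := hQ.exists_retraction _ ((hQ.factorsThroughFG.ker_retraction h).prod hL)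
    (pr.prod (j ∘ₗ r)) <| (injective_iff_map_eq_zero _).2 fun x hx => by
      have h1 : r x = 0 := hj ((congrArg Prod.snd hx).trans (map_zero j).symm)
      have h2 : x - i (r x) = 0 := congrArg Subtype.val (congrArg Prod.fst hx)
      simpa [h1] using h2
  refine ⟨r ∘ₗ ρ ∘ₗ LinearMap.inr Λ _ L, fun x => ?_⟩
  have h1 : ρ (pr (i x), j (r (i x))) = i x := hρ (i x)
  have h2 : pr (i x) = 0 := Subtype.ext (by simp [hpr, h])
  rw [h2, h] at h1
  exact (congrArg r h1).trans (h x)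

theorem prod (hQ : IsFactorsRelInjective Λ Q) (hR : IsFactorsRelInjective Λ R) :
    IsFactorsRelInjective Λ (Q × R) := by
  refine ⟨hQ.factorsThroughFG.prod hR.factorsThroughFG, fun L _ _ hL i hi => ?_⟩
  obtain ⟨r₁, hr₁⟩ := hQ.exists_retraction L hL (i ∘ₗ LinearMap.inl Λ Q R)
    (hi.comp LinearMap.inl_injective)
  have hr₁ (x) : r₁ (i (x, 0)) = x := hr₁ x
  let pr : L →ₗ[Λ] LinearMap.ker r₁ :=
    (LinearMap.id - i ∘ₗ LinearMap.inl Λ Q R ∘ₗ r₁).codRestrict (LinearMap.ker r₁)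
      fun x => by simp [hr₁]
  have hpr (x) : (pr x : L) = x - i (r₁ x, 0) := rfl
  obtain ⟨r₂, hr₂⟩ := hR.exists_retraction _
    (hL.ker_retraction (i := i ∘ₗ LinearMap.inl Λ Q R) hr₁) (pr ∘ₗ i ∘ₗ LinearMap.inr Λ Q R) <|
    (injective_iff_map_eq_zero _).2 fun y hy => by
      have h1 : i (0, y) - i (r₁ (i (0, y)), 0) = 0 := congrArg Subtype.val hy
      exact congrArg Prod.snd (hi (sub_eq_zero.1 h1))
  have hr₂ (y) : r₂ (pr (i (0, y))) = y := hr₂ y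
  let s := r₂ ∘ₗ pr
  refine ⟨(r₁ ∘ₗ (LinearMap.id - i ∘ₗ LinearMap.inr Λ Q R ∘ₗ s)).prod s, fun q => ?_⟩
  have hs : s (i q) = q.2 := by
    have h1 : i q = i (q.1, 0) + i (0, q.2) := by rw [← map_add]; simp
    have h2 : pr (i (q.1, 0)) = 0 := Subtype.ext (by simp [hpr, hr₁])
    change r₂ (pr (i q)) = _
    rw [h1, map_add, h2, zero_add, hr₂]
  refine Prod.ext ?_ hs
  change r₁ (i q - i (0, s (i q))) = q.1
  rw [hs, ← map_sub, ← hr₁ q.1]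
  congr 2
  simp [Prod.ext_iff]

theorem exists_extension {X Y Z : Type u} [AddCommGroup X] [AddCommGroup Y]
    [AddCommGroup Z] [Module Λ X] [Module Λ Y] [Module Λ Z]
    {i : X →ₗ[Λ] Y} {p : Y →ₗ[Λ] Z} (hi : Function.Injective i) (hip : Function.Exact i p)
    (hp : Function.Surjective p) (hZ : FactorsThroughFG Λ Z) (hQ : IsFactorsRelInjective Λ Q)
    (u : X →ₗ[Λ] Q) : ∃ v : Y →ₗ[Λ] Q, ∀ x, v (i x) = u x := by
  obtain ⟨E, _, _, a, b, c, ha, hac, hc, hab, -⟩ := LinearMap.exists_pushout_of_exact hi hip hp u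
  obtain ⟨r, hr⟩ := hQ.exists_retraction E (.of_exact ha hac hc hQ.factorsThroughFG hZ) a ha
  exact ⟨r ∘ₗ b, fun x => by simp [← hab, hr]⟩

end IsFactorsRelInjective

end RelInjective

section Coresolution

/-- The modules `M` admitting an exact sequence `0 → M → Q₀ → ⋯ → Qₘ₋₁ → N → 0` where each `Qᵢ`
satisfies `IsFactorsRelInjective` and all the cosyzygies satisfy `FactorsThroughFG`. -/
def HasRelCoresolution (Λ : Type u) [Ring Λ] :
    ℕ → ∀ (M : Type u) [AddCommGroup M] [Module Λ M], Prop
  | 0, M, _, _ => FactorsThroughFG Λ M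
  | m + 1, M, _, _ => FactorsThroughFG Λ M ∧
      ∃ (Q N : Type u) (_ : AddCommGroup Q) (_ : AddCommGroup N) (_ : Module Λ Q) (_ : Module Λ N)
        (i : M →ₗ[Λ] Q) (p : Q →ₗ[Λ] N), Function.Injective i ∧ Function.Exact i p ∧
          Function.Surjective p ∧ IsFactorsRelInjective Λ Q ∧ HasRelCoresolution Λ m N

namespace HasRelCoresolution

variable {Λ : Type u} [Ring Λ]

theorem factorsThroughFG {m : ℕ} {M : Type u} [AddCommGroup M] [Module Λ M]
    (h : HasRelCoresolution Λ m M) : FactorsThroughFG Λ M := by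
  cases m with
  | zero => exact h
  | succ m => exact h.1

theorem finsupp (K : Type u) [Field K] [Algebra K Λ] [FiniteDimensional K Λ]
    (h : ContravariantlyFinite Λ) (J : Type u) (m : ℕ) (C : Type u) [AddCommGroup C] [Module Λ C]
    (hC : IsFGFinProjDim Λ C) : HasRelCoresolution Λ m (J →₀ C) := by
  induction m generalizing C with
  | zero => exact FactorsThroughFG.finsupp hC J
  | succ m ih =>
    obtain ⟨T, _, _, i, hT, hT', hi⟩ := h.exists_embedding K C hC
    have hip := LinearMap.exact_map_mkQ_range i
    have hN := hC.of_exact_right hi hip (Submodule.mkQ_surjective _) hT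
    refine ⟨FactorsThroughFG.finsupp hC J, J →₀ T, J →₀ _, _, _, _, _, Finsupp.mapRange.linearMap i,
      Finsupp.mapRange.linearMap (LinearMap.range i).mkQ,
      Finsupp.mapRange_injective _ (map_zero _) hi, ?_,
      Finsupp.mapRange_surjective _ (map_zero _) (Submodule.mkQ_surjective _),
      hT'.isFactorsRelInjective_finsupp K hT J, ih _ hN⟩
    rw [LinearMap.exact_iff, Finsupp.ker_mapRange, Finsupp.range_mapRange_linearMap _
      (LinearMap.ker_eq_bot.2 hi), Submodule.ker_mkQ]

variable [IsNoetherianRing Λ]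

theorem of_exact_middle (m : ℕ) {X Y Z : Type u} [AddCommGroup X] [AddCommGroup Y]
    [AddCommGroup Z] [Module Λ X] [Module Λ Y] [Module Λ Z] {f : X →ₗ[Λ] Y} {g : Y →ₗ[Λ] Z}
    (hf : Function.Injective f) (hfg : Function.Exact f g) (hg : Function.Surjective g)
    (hX : HasRelCoresolution Λ m X) (hZ : HasRelCoresolution Λ m Z) :
    HasRelCoresolution Λ m Y := by
  induction m generalizing X Y Z with
  | zero => exact .of_exact hf hfg hg hX hZ
  | succ m ih =>
    obtain ⟨hX, Q, N, _, _, _, _, i, p, hi, hip, hp, hQ, hN⟩ := hX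
    obtain ⟨hZ, Q', N', _, _, _, _, i', p', hi', hip', hp', hQ', hN'⟩ := hZ
    obtain ⟨e, he⟩ := hQ.exists_extension hf hfg hg hZ i
    let k := e.prod (i' ∘ₗ g)
    have hk : Function.Injective k := (injective_iff_map_eq_zero _).2 fun y hy => by
      obtain ⟨x, rfl⟩ := (hfg y).1 (hi' ((congrArg Prod.snd hy).trans (map_zero i').symm))
      have h1 : e (f x) = 0 := congrArg Prod.fst hy
      rw [he] at h1
      rw [hi (h1.trans (map_zero i).symm), map_zero]
    let π := (LinearMap.range k).mkQ
    have hπ : Function.Surjective π := Submodule.mkQ_surjective _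
    have hkπ : Function.Exact k π := LinearMap.exact_map_mkQ_range k
    obtain ⟨α, hα⟩ := LinearMap.exists_comp_eq_of_ker_le p hp (π ∘ₗ LinearMap.inl Λ Q Q')
      fun q hq => by
        obtain ⟨x, rfl⟩ := (hip q).1 hq
        exact (hkπ _).2 ⟨f x, Prod.ext (he x) (by simp [k, hfg.apply_apply_eq_zero])⟩
    obtain ⟨β, hβ⟩ := LinearMap.exists_comp_eq_of_ker_le π hπ (p' ∘ₗ LinearMap.snd Λ Q Q')
      fun q hq => by
        obtain ⟨y, rfl⟩ := (hkπ q).1 hq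
        exact hip'.apply_apply_eq_zero (g y)
    refine ⟨.of_exact hf hfg hg hX hZ, _, _, _, _, _, _, k, π, hk, hkπ, hπ, hQ.prod hQ',
      ih (f := α) (g := β) ?_ ?_ ?_ hN hN'⟩
    · refine (injective_iff_map_eq_zero α).2 fun n hn => ?_
      obtain ⟨q, rfl⟩ := hp n
      rw [hα] at hn
      obtain ⟨y, hy⟩ := (hkπ _).1 hn
      obtain ⟨x, rfl⟩ := (hfg y).1 (hi' ((congrArg Prod.snd hy).trans (map_zero i').symm))
      have h1 : e (f x) = q := congrArg Prod.fst hy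
      rw [← h1, he, hip.apply_apply_eq_zero]
    · intro z
      constructor
      · intro hz
        obtain ⟨⟨a, b⟩, rfl⟩ := hπ z
        rw [hβ] at hz
        obtain ⟨z, rfl⟩ := (hip' b).1 hz
        obtain ⟨y, rfl⟩ := hg z
        refine ⟨p (a - e y), ?_⟩
        rw [hα, ← sub_eq_zero, LinearMap.comp_apply, ← map_sub]
        exact (hkπ _).2 ⟨-y, Prod.ext (by simp [k]) (by simp [k])⟩
      · rintro ⟨n, rfl⟩
        obtain ⟨q, rfl⟩ := hp n
        rw [hα, LinearMap.comp_apply, hβ]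
        simp
    · intro n
      obtain ⟨b, rfl⟩ := hp' n
      exact ⟨π (0, b), hβ _⟩

theorem of_exact_relInjective (m : ℕ) {Q Y Z : Type u} [AddCommGroup Q] [AddCommGroup Y]
    [AddCommGroup Z] [Module Λ Q] [Module Λ Y] [Module Λ Z] {i : Q →ₗ[Λ] Y} {p : Y →ₗ[Λ] Z}
    (hi : Function.Injective i) (hip : Function.Exact i p) (hp : Function.Surjective p)
    (hQ : IsFactorsRelInjective Λ Q) (hY : HasRelCoresolution Λ m Y) :
    HasRelCoresolution Λ m Z := by
  obtain ⟨r, hr⟩ := hQ.exists_retraction Y hY.factorsThroughFG i hi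
  obtain ⟨s, hs⟩ := LinearMap.exists_comp_eq_of_ker_le p hp (LinearMap.id - i ∘ₗ r)
    fun y hy => by
      obtain ⟨q, rfl⟩ := (hip y).1 hy
      simp [hr]
  have hZ : FactorsThroughFG Λ Z := .of_retract (i := s) (r := p) (fun z => by
    obtain ⟨y, rfl⟩ := hp z
    simp [hs, hip.apply_apply_eq_zero]) hY.factorsThroughFG
  cases m with
  | zero => exact hZ
  | succ m =>
    obtain ⟨hY, W, N, _, _, _, _, j, π, hj, hjπ, hπ, hW, hN⟩ := hY
    obtain ⟨r, hr⟩ := hQ.exists_retraction W hW.factorsThroughFG (j ∘ₗ i) (hj.comp hi)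
    have hr (q) : r (j (i q)) = q := hr q
    let pr : W →ₗ[Λ] LinearMap.ker r :=
      (LinearMap.id - j ∘ₗ i ∘ₗ r).codRestrict (LinearMap.ker r) fun x => by simp [hr]
    have hpr (x) : (pr x : W) = x - j (i (r x)) := rfl
    have hpr' (x : LinearMap.ker r) : pr x = x :=
      Subtype.ext (by rw [hpr, LinearMap.mem_ker.1 x.2]; simp)
    obtain ⟨f, hf⟩ := LinearMap.exists_comp_eq_of_ker_le p hp (pr ∘ₗ j) fun y hy => by
      obtain ⟨q, rfl⟩ := (hip y).1 hy
      exact Subtype.ext (by simp [hpr, hr])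
    refine ⟨hZ, LinearMap.ker r, N, _, _, _, _, f, π ∘ₗ (LinearMap.ker r).subtype, ?_, ?_, ?_,
      hW.of_retract (i := (LinearMap.ker r).subtype) (r := pr) hpr', hN⟩
    · refine (injective_iff_map_eq_zero f).2 fun z hz => ?_
      obtain ⟨y, rfl⟩ := hp z
      rw [hf] at hz
      have h1 : j y - j (i (r (j y))) = 0 := congrArg Subtype.val hz
      rw [hj (sub_eq_zero.1 h1), hip.apply_apply_eq_zero]
    · intro x
      constructor
      · intro hx
        obtain ⟨y, hy⟩ := (hjπ x).1 hx
        exact ⟨p y, by rw [hf, LinearMap.comp_apply, hy, hpr']⟩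
      · rintro ⟨z, rfl⟩
        obtain ⟨y, rfl⟩ := hp z
        rw [hf]
        simp [hpr, hjπ.apply_apply_eq_zero]
    · intro n
      obtain ⟨w, rfl⟩ := hπ n
      exact ⟨pr w, by simp [hpr, hjπ.apply_apply_eq_zero]⟩

theorem of_exact_right {m : ℕ} {X Y Z : Type u} [AddCommGroup X] [AddCommGroup Y]
    [AddCommGroup Z] [Module Λ X] [Module Λ Y] [Module Λ Z] {f : X →ₗ[Λ] Y} {g : Y →ₗ[Λ] Z}
    (hf : Function.Injective f) (hfg : Function.Exact f g) (hg : Function.Surjective g)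
    (hX : HasRelCoresolution Λ (m + 1) X) (hY : HasRelCoresolution Λ m Y) :
    HasRelCoresolution Λ m Z := by
  obtain ⟨-, Q, N, _, _, _, _, i, p, hi, hip, hp, hQ, hN⟩ := hX
  obtain ⟨E, _, _, a, b, c, ha, hac, hc, -, hb, hd⟩ := LinearMap.exists_pushout_of_exact hf hfg hg i
  obtain ⟨d, hbd, hd⟩ := hd N p hip hp
  exact of_exact_relInjective m ha hac hc hQ (of_exact_middle m (hb hi) hbd hd hY hN)

theorem of_projective (K : Type u) [Field K] [Algebra K Λ] [FiniteDimensional K Λ]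
    (h : ContravariantlyFinite Λ) (m : ℕ) (P : Type u) [AddCommGroup P] [Module Λ P]
    [Module.Projective Λ P] : HasRelCoresolution Λ m P := by
  induction m generalizing P with
  | zero => exact FactorsThroughFG.of_projective P
  | succ m ih =>
    obtain ⟨s, hs⟩ := Module.projective_def'.1 ‹Module.Projective Λ P›
    let q : (P →₀ Λ) →ₗ[Λ] P := Finsupp.linearCombination Λ id
    have hs (x) : q (s x) = x := LinearMap.congr_fun hs x
    obtain ⟨-, Q, N, _, _, _, _, i, p, hi, hip, hp, hQ, hN⟩ :=
      finsupp K h P (m + 1) Λ .of_projective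
    let pr : (P →₀ Λ) →ₗ[Λ] LinearMap.ker q :=
      (LinearMap.id - s ∘ₗ q).codRestrict (LinearMap.ker q) fun x => by simp [hs]
    have hpr (x) : (pr x : P →₀ Λ) = x - s (q x) := rfl
    have : Module.Projective Λ (LinearMap.ker q) := .of_split (LinearMap.ker q).subtype pr <|
      LinearMap.ext fun x => Subtype.ext (by simp [hpr, LinearMap.mem_ker.1 x.2])
    have hsi := LinearMap.exact_map_mkQ_range (i ∘ₗ s)
    let π := (LinearMap.range (i ∘ₗ s)).mkQ
    have hπ : Function.Surjective π := Submodule.mkQ_surjective _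
    have hinj : Function.Injective (i ∘ₗ s) := hi.comp (Function.LeftInverse.injective hs)
    obtain ⟨β, hβ⟩ := LinearMap.exists_comp_eq_of_ker_le π hπ p fun z hz => by
      obtain ⟨x, rfl⟩ := (hsi z).1 hz
      exact hip.apply_apply_eq_zero (s x)
    refine ⟨.of_projective P, Q, _, _, _, _, _, i ∘ₗ s, π, hinj, hsi, hπ, hQ,
      of_exact_middle m (f := π ∘ₗ i ∘ₗ (LinearMap.ker q).subtype) (g := β) ?_ ?_ ?_
        (ih ↥(LinearMap.ker q)) hN⟩
    · refine (injective_iff_map_eq_zero _).2 fun x hx => ?_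
      obtain ⟨y, hy⟩ := (hsi _).1 hx
      have hy : s y = x := hi hy
      have h1 : q x = 0 := x.2
      rw [← hy, hs] at h1
      exact Subtype.ext (by rw [← hy, h1, map_zero]; rfl)
    · intro z
      constructor
      · intro hz
        obtain ⟨z, rfl⟩ := hπ z
        rw [hβ] at hz
        obtain ⟨x, rfl⟩ := (hip z).1 hz
        refine ⟨pr x, ?_⟩
        rw [← sub_eq_zero, LinearMap.comp_apply, ← map_sub]
        exact (hsi _).2 ⟨-q x, by simp [hpr]⟩
      · rintro ⟨x, rfl⟩
        exact (hβ _).trans (hip.apply_apply_eq_zero _)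
    · intro n
      obtain ⟨z, rfl⟩ := hp n
      exact ⟨π z, hβ z⟩

theorem of_hasProjDimLE (K : Type u) [Field K] [Algebra K Λ] [FiniteDimensional K Λ]
    (h : ContravariantlyFinite Λ) (n : ℕ) (M : ModuleCat.{u} Λ) (hM : HasProjDimLE Λ n M)
    (m : ℕ) : HasRelCoresolution Λ m M := by
  induction n generalizing M m with
  | zero =>
    have : Module.Projective Λ M := hM
    exact of_projective K h m M
  | succ n ih =>
    obtain ⟨P, g, _, hg, hK⟩ := hM
    exact of_exact_right (LinearMap.ker g).subtype_injective (LinearMap.exact_subtype_ker_map g) hg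
      (ih _ hK (m + 1)) (of_projective K h m P)

end HasRelCoresolution

end Coresolution

section DirectLimit

variable (Λ : Type u) [Ring Λ] (M : Type u)

/-- The free module on generators labelled by an element of `M` and a natural number. -/
def LabelledFree : Type u := (M × ℕ) →₀ Λ

namespace LabelledFree

noncomputable instance : AddCommGroup (LabelledFree Λ M) :=
  inferInstanceAs (AddCommGroup ((M × ℕ) →₀ Λ))

noncomputable instance : Module Λ (LabelledFree Λ M) :=
  inferInstanceAs (Module Λ ((M × ℕ) →₀ Λ))

variable {M} in
/-- The generator with label `j`. -/
noncomputable def gen (j : M × ℕ) : LabelledFree Λ M := Finsupp.single j 1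

variable {Λ M} in
/-- The linear map with prescribed values on the generators. -/
noncomputable def lift {C : Type u} [AddCommGroup C] [Module Λ C] (c : M × ℕ → C) :
    LabelledFree Λ M →ₗ[Λ] C :=
  Finsupp.linearCombination Λ c

@[simp]
theorem lift_gen {C : Type u} [AddCommGroup C] [Module Λ C] (c : M × ℕ → C) (j : M × ℕ) :
    lift c (gen Λ j) = c j :=
  (Finsupp.linearCombination_single Λ 1 j).trans (one_smul Λ _)

variable {M} in
/-- The submodule spanned by a finite set of generators. -/
noncomputable def spanGen (I : Finset (M × ℕ)) : Submodule Λ (LabelledFree Λ M) :=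
  Submodule.span Λ (gen Λ '' (I : Set (M × ℕ)))

variable {M} in
theorem gen_mem_spanGen {I : Finset (M × ℕ)} {j : M × ℕ} (hj : j ∈ I) : gen Λ j ∈ spanGen Λ I :=
  Submodule.subset_span ⟨j, hj, rfl⟩

variable {M} in
theorem spanGen_mono {I I' : Finset (M × ℕ)} (h : I ⊆ I') : spanGen Λ I ≤ spanGen Λ I' :=
  Submodule.span_mono (Set.image_mono (Finset.coe_subset.2 h))

instance (I : Finset (M × ℕ)) : Module.Finite Λ (spanGen Λ I) :=
  .span_of_finite Λ (I.finite_toSet.image _)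

variable {Λ M} in
theorem ext_spanGen {C : Type u} [AddCommGroup C] [Module Λ C] {I : Finset (M × ℕ)}
    {φ ψ : spanGen Λ I →ₗ[Λ] C}
    (h : ∀ j (hj : j ∈ I), φ ⟨gen Λ j, gen_mem_spanGen Λ hj⟩ = ψ ⟨gen Λ j, gen_mem_spanGen Λ hj⟩) :
    φ = ψ := by
  refine LinearMap.ext_on_range (v := fun j : I => ⟨gen Λ j.1, gen_mem_spanGen Λ j.2⟩) ?_
    fun j => h j.1 j.2
  apply Submodule.map_injective_of_injective (spanGen Λ I).subtype_injective
  rw [Submodule.map_span, Submodule.map_subtype_top, ← Set.range_comp]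
  exact congrArg (Submodule.span Λ) <| Set.ext fun z => by simp

variable [AddCommGroup M] [Module Λ M]

/-- The canonical projection, forgetting the labels. -/
noncomputable def proj : LabelledFree Λ M →ₗ[Λ] M := lift Prod.fst

/-- The module with generators the finite set `I` and relations `N`. -/
abbrev Presented (I : Finset (M × ℕ)) (N : Submodule Λ (LabelledFree Λ M)) : Type u :=
  spanGen Λ I ⧸ N.submoduleOf (spanGen Λ I)

end LabelledFree

variable [AddCommGroup M] [Module Λ M]

/-- The finite presentations over `M`, by elements of `M`, of modules of finite projective
dimension. -/
structure FinProjDimPresentation where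
  gens : Finset (M × ℕ)
  rels : Submodule Λ (LabelledFree Λ M)
  rels_le_spanGen : rels ≤ LabelledFree.spanGen Λ gens
  rels_le_ker : rels ≤ LinearMap.ker (LabelledFree.proj Λ M)
  isFGFinProjDim : IsFGFinProjDim Λ (LabelledFree.Presented Λ M gens rels)

variable {Λ M}

open LabelledFree

noncomputable instance : Preorder (FinProjDimPresentation Λ M) :=
  Preorder.lift fun x => (x.gens, x.rels)

/-- Finitely presented modules over `M` map to finitely presented modules of finite projective
dimension over `M`. -/
theorem FactorsThroughFG.exists_presentation (hM : FactorsThroughFG Λ M) (I : Finset (M × ℕ))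
    (N : Submodule Λ (LabelledFree Λ M)) (hNI : N ≤ spanGen Λ I)
    (hN : N ≤ LinearMap.ker (proj Λ M)) :
    ∃ x : FinProjDimPresentation Λ M, I ⊆ x.gens ∧ N ≤ x.rels := by
  classical
  let S := spanGen Λ I
  obtain ⟨C, _, _, a, b, hC, hab⟩ := hM (S ⧸ N.submoduleOf S) inferInstance
    ((N.submoduleOf S).liftQ (proj Λ M ∘ₗ S.subtype) fun y hy => hN hy)
  have hab (y : S) : b (a (Submodule.Quotient.mk y)) = proj Λ M y := hab _
  have := hC.finite
  obtain ⟨n, c, hc⟩ := Module.Finite.exists_fin (R := Λ) (M := C)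
  let ℓ (k : Fin n) : M × ℕ := (b (c k), I.sup Prod.snd + 1 + k)
  have hℓ : Function.Injective ℓ := fun k k' h => Fin.ext <|
    Nat.add_left_cancel (congrArg Prod.snd h)
  have hℓI (k) : ℓ k ∉ I := fun h => by
    have := Finset.le_sup (f := Prod.snd) h
    simp only [ℓ] at this
    lia
  let φ₀ (j : M × ℕ) : C := if hj : j ∈ I then
    a (Submodule.Quotient.mk ⟨gen Λ j, gen_mem_spanGen Λ hj⟩)
    else Function.extend ℓ c 0 j
  let φ : LabelledFree Λ M →ₗ[Λ] C := lift φ₀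
  have hφℓ (k) : φ (gen Λ (ℓ k)) = c k := by
    simp [φ, φ₀, hℓI, hℓ.extend_apply]
  have hφI (y : S) : φ y = a (Submodule.Quotient.mk y) := by
    refine LinearMap.congr_fun (f := φ ∘ₗ S.subtype) (g := a ∘ₗ Submodule.mkQ _)
      (ext_spanGen fun j hj => ?_) y
    simp [φ, φ₀, hj]
  let I' := I ∪ Finset.univ.image ℓ
  let S' := spanGen Λ I'
  have hbφ : S' ≤ LinearMap.eqLocus (b ∘ₗ φ) (proj Λ M) := by
    refine Submodule.span_le.2 ?_
    rintro _ ⟨j, hj, rfl⟩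
    obtain hj | hj := Finset.mem_union.1 (Finset.mem_coe.1 hj)
    · exact (congrArg b (hφI ⟨_, gen_mem_spanGen Λ hj⟩)).trans (hab _)
    · obtain ⟨k, -, rfl⟩ := Finset.mem_image.1 hj
      change b (φ _) = _
      rw [hφℓ]
      simp [proj, ℓ]
  have hφS' : Function.Surjective (φ ∘ₗ S'.subtype) := by
    rw [← LinearMap.range_eq_top, eq_top_iff, ← hc, Submodule.span_le]
    rintro _ ⟨k, rfl⟩
    exact ⟨⟨gen Λ (ℓ k), gen_mem_spanGen Λ (by simp [I'])⟩, hφℓ k⟩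
  refine ⟨⟨I', S' ⊓ LinearMap.ker φ, inf_le_left, fun y hy => ?_, .of_equiv
    ((Submodule.quotEquivOfEq _ _ ?_).trans
      ((φ ∘ₗ S'.subtype).quotKerEquivOfSurjective hφS')).symm hC⟩,
    Finset.subset_union_left, fun y hy => ⟨?_, ?_⟩⟩
  · have h1 : b (φ y) = proj Λ M y := hbφ hy.1
    have h2 : φ y = 0 := hy.2
    rw [LinearMap.mem_ker, ← h1, h2, map_zero]
  · ext y
    exact ⟨fun h => h.2, fun h => ⟨y.2, h⟩⟩
  · exact spanGen_mono Λ Finset.subset_union_left (hNI hy)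
  · exact (hφI ⟨y, hNI hy⟩).trans <| by
      rw [(Submodule.Quotient.mk_eq_zero (N.submoduleOf S) (x := ⟨y, hNI hy⟩)).2 hy, map_zero]

theorem FactorsThroughFG.isDirectLimit (hM : FactorsThroughFG Λ M) :
    IsDirectLimitOfFGFinProjDim Λ (ModuleCat.of Λ M) := by
  classical
  let G (x : FinProjDimPresentation Λ M) : ModuleCat.{u} Λ :=
    ModuleCat.of Λ (Presented Λ M x.gens x.rels)
  let f (x y : FinProjDimPresentation Λ M) (h : x ≤ y) : G x →ₗ[Λ] G y :=
    Submodule.mapQ (x.rels.submoduleOf (spanGen Λ x.gens)) (y.rels.submoduleOf (spanGen Λ y.gens))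
      (Submodule.inclusion (spanGen_mono Λ h.1)) fun _ hz => h.2 hz
  let mk (x : FinProjDimPresentation Λ M) : spanGen Λ x.gens →ₗ[Λ] G x := Submodule.mkQ _
  have hmk (x) : Function.Surjective (mk x) := Submodule.mkQ_surjective _
  let g (x : FinProjDimPresentation Λ M) : G x →ₗ[Λ] M :=
    Submodule.liftQ _ (proj Λ M ∘ₗ Submodule.subtype _) fun z hz => x.rels_le_ker hz
  have hg (x z) : g x (mk x z) = proj Λ M z := rfl
  have hgf (x y h z) : g y (f x y h z) = g x z := by
    obtain ⟨z, rfl⟩ := hmk x z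
    rfl
  have hdir : IsDirected (FinProjDimPresentation Λ M) (· ≤ ·) := ⟨fun x y => by
    obtain ⟨z, hz, hz'⟩ := hM.exists_presentation (x.gens ∪ y.gens) (x.rels ⊔ y.rels)
      (sup_le (x.rels_le_spanGen.trans (spanGen_mono Λ Finset.subset_union_left))
        (y.rels_le_spanGen.trans (spanGen_mono Λ Finset.subset_union_right)))
      (sup_le x.rels_le_ker y.rels_le_ker)
    exact ⟨z, ⟨Finset.union_subset_left hz, le_sup_left.trans hz'⟩,
      ⟨Finset.union_subset_right hz, le_sup_right.trans hz'⟩⟩⟩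
  have hne : Nonempty (FinProjDimPresentation Λ M) :=
    ⟨(hM.exists_presentation ∅ ⊥ bot_le bot_le).choose⟩
  refine ⟨_, inferInstance, inferInstance, hne, hdir, G, f,
    ⟨fun x z => ?_, fun {x y z} h h' w => ?_⟩,
    fun x => ⟨x.isFGFinProjDim.finite, x.isFGFinProjDim.hasFinProjDim⟩,
    ⟨.ofBijective (Module.DirectLimit.lift Λ _ _ f g hgf) ⟨?_, fun m => ?_⟩⟩⟩
  · obtain ⟨z, rfl⟩ := hmk x z
    rfl
  · obtain ⟨w, rfl⟩ := hmk _ w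
    rfl
  · refine (injective_iff_map_eq_zero _).2 fun z hz => ?_
    obtain ⟨x, z, rfl⟩ := Module.DirectLimit.exists_of z
    obtain ⟨z, rfl⟩ := hmk x z
    rw [Module.DirectLimit.lift_of, hg] at hz
    obtain ⟨y, hy, hy'⟩ := hM.exists_presentation x.gens (x.rels ⊔ Submodule.span Λ {z.1})
      (sup_le x.rels_le_spanGen (by simp)) (sup_le x.rels_le_ker (by simpa))
    have hxy : x ≤ y := ⟨hy, le_sup_left.trans hy'⟩
    have : f x y hxy (mk x z) = 0 := (Submodule.Quotient.mk_eq_zero _).2 <|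
      hy' (Submodule.mem_sup_right (Submodule.mem_span_singleton_self _))
    rw [← Module.DirectLimit.of_f (hij := hxy), this, map_zero]
  · obtain ⟨x, hx, -⟩ := hM.exists_presentation {(m, 0)} ⊥ bot_le bot_le
    refine ⟨Module.DirectLimit.of Λ _ _ f x (mk x ⟨gen Λ (m, 0),
      gen_mem_spanGen Λ (hx (by simp))⟩), ?_⟩
    rw [Module.DirectLimit.lift_of, hg]
    simp [proj]

end DirectLimit

/-- If `P^∞(Λ-mod)` is contravariantly finite in `Λ-mod`, then every left
`Λ`-module (not necessarily finitely generated) of finite projective dimension is a direct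
limit of a directed system of finitely generated left `Λ`-modules of finite projective
dimension. -/
theorem contravariantlyFinite_implies_directLimit
    (K : Type u) (Λ : Type u) [Field K] [Ring Λ] [Algebra K Λ] [FiniteDimensional K Λ]
    (h : ContravariantlyFinite Λ) :
    ∀ M : ModuleCat.{u} Λ, HasFinProjDim Λ M → IsDirectLimitOfFGFinProjDim Λ M := by
  rintro M ⟨n, hn⟩
  have : IsNoetherianRing Λ := .of_finite K Λ
  exact (HasRelCoresolution.of_hasProjDimLE K h n M hn 0).factorsThroughFG.isDirectLimit
end
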